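/- Let f₀, ρ₀ : [0,1] → ℝ be smooth with f₀ not identically zero, f₀(0) = f₀(1) = 0, ρ₀(0) = ρ₀(1) = 0, and ρ₀(x) ≥ 0 for all x ∈ [0,1]. Suppose M₀ := max_{x∈[0,1]} f₀'(x) > 0 is attained exactly at the two points x = 0 and x = 1, with f₀''(0) < 0 and f₀''(1) > 0. Let (f, ρ) be a classical solution of the reduced Boussinesq system f_{xt} + f f_{xx} - f_x² + ρ = I(t), ρ_t + f ρ_x = ρ f_x on [0,T) × [0,1], with I(t) = ∫₀¹ ρ dx - 2∫₀¹ f_x² dx, boundary conditions f(t,0) = f(t,1) = 0, ρ(t,0) = ρ(t,1) = 0, and initial data f(0,·) = f₀, ρ(0,·) = ρ₀, defined on a maximal interval [0,T) (i.e. it cannot be extended to a classical solution on any larger time interval). Then T < +∞, lim_{t→T⁻} f_{xx}(t,0) = -∞, and lim_{t→T⁻} f_{xx}(t,1) = +∞. -/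

import Mathlib

open Set MeasureTheory Filter
open scoped ENNReal Topology

/-- The time interval `[0,T)` for an extended-real final time `T : ℝ≥0∞`, viewed as a set
of real times. -/
def timeSet (T : ℝ≥0∞) : Set ℝ := {t : ℝ | 0 ≤ t ∧ ENNReal.ofReal t < T}

/-- A classical solution of the reduced Boussinesq system
`f_{xt} + f f_{xx} - f_x² + ρ = I(t)`, `ρ_t + f ρ_x = ρ f_x` on `[0,T) × [0,1]`
(with possibly infinite final time `T`), where `I(t) = ∫₀¹ ρ dx - 2 ∫₀¹ f_x² dx`, with
boundary conditions `f(t,0) = f(t,1) = 0` and `ρ(t,0) = ρ(t,1) = 0`.  The functions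
`fx, fxx, fxt, ρt, ρx` are the indicated partial derivatives of `f` and `ρ`. -/
structure IsClassicalSol (T : ℝ≥0∞) (f ρ fx fxx fxt ρt ρx : ℝ → ℝ → ℝ) : Prop where
  hfx : ∀ t ∈ timeSet T, ∀ x ∈ Icc (0:ℝ) 1, HasDerivAt (f t) (fx t x) x
  hfxx : ∀ t ∈ timeSet T, ∀ x ∈ Icc (0:ℝ) 1, HasDerivAt (fx t) (fxx t x) x
  hfxt : ∀ t ∈ timeSet T, ∀ x ∈ Icc (0:ℝ) 1, HasDerivAt (fun s => fx s x) (fxt t x) t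
  hρt : ∀ t ∈ timeSet T, ∀ x ∈ Icc (0:ℝ) 1, HasDerivAt (fun s => ρ s x) (ρt t x) t
  hρx : ∀ t ∈ timeSet T, ∀ x ∈ Icc (0:ℝ) 1, HasDerivAt (ρ t) (ρx t x) x
  hcf : ContinuousOn (fun p : ℝ × ℝ => f p.1 p.2) (timeSet T ×ˢ Icc (0:ℝ) 1)
  hcρ : ContinuousOn (fun p : ℝ × ℝ => ρ p.1 p.2) (timeSet T ×ˢ Icc (0:ℝ) 1)
  hcfx : ContinuousOn (fun p : ℝ × ℝ => fx p.1 p.2) (timeSet T ×ˢ Icc (0:ℝ) 1)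
  hcfxx : ContinuousOn (fun p : ℝ × ℝ => fxx p.1 p.2) (timeSet T ×ˢ Icc (0:ℝ) 1)
  hcfxt : ContinuousOn (fun p : ℝ × ℝ => fxt p.1 p.2) (timeSet T ×ˢ Icc (0:ℝ) 1)
  hcρt : ContinuousOn (fun p : ℝ × ℝ => ρt p.1 p.2) (timeSet T ×ˢ Icc (0:ℝ) 1)
  hcρx : ContinuousOn (fun p : ℝ × ℝ => ρx p.1 p.2) (timeSet T ×ˢ Icc (0:ℝ) 1)
  hpde1 : ∀ t ∈ timeSet T, ∀ x ∈ Icc (0:ℝ) 1,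
    fxt t x + f t x * fxx t x - (fx t x) ^ 2 + ρ t x
      = (∫ y in (0:ℝ)..1, ρ t y) - 2 * ∫ y in (0:ℝ)..1, (fx t y) ^ 2
  hpde2 : ∀ t ∈ timeSet T, ∀ x ∈ Icc (0:ℝ) 1,
    ρt t x + f t x * ρx t x = ρ t x * fx t x
  hbcf : ∀ t ∈ timeSet T, f t 0 = 0 ∧ f t 1 = 0
  hbcρ : ∀ t ∈ timeSet T, ρ t 0 = 0 ∧ ρ t 1 = 0

section

open scoped NNReal

/-- The primitive in the second variable of a function continuous on `J × [0,1]` is continuous. -/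
lemma continuousOn_primitive_param {J : Set ℝ} {φ : ℝ → ℝ → ℝ}
    (hφ : ContinuousOn (fun p : ℝ × ℝ => φ p.1 p.2) (J ×ˢ Icc (0:ℝ) 1)) :
    ContinuousOn (fun p : ℝ × ℝ => ∫ b in (0:ℝ)..p.2, φ p.1 b) (J ×ˢ Icc (0:ℝ) 1) := by
  rw [continuousOn_iff_continuous_domRestrict]
  have h1 : Continuous (Function.uncurry
      (fun (p : ↥(J ×ˢ Icc (0:ℝ) 1)) (b : ℝ) => φ p.1.1 (projIcc (0:ℝ) 1 zero_le_one b))) := by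
    have : Continuous (fun q : ↥(J ×ˢ Icc (0:ℝ) 1) × ℝ =>
        ((q.1.1.1, (projIcc (0:ℝ) 1 zero_le_one q.2 : ℝ)) : ℝ × ℝ)) := by
      have := (continuous_projIcc (a := (0:ℝ)) (b := 1) (h := zero_le_one))
      fun_prop
    exact hφ.comp_continuous this fun q => ⟨q.1.2.1, Subtype.coe_prop _⟩
  have h2 := intervalIntegral.continuous_parametric_intervalIntegral_of_continuous
    (μ := volume) (a₀ := (0:ℝ)) h1 (s := fun p : ↥(J ×ˢ Icc (0:ℝ) 1) => p.1.2) (by fun_prop)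
  refine h2.congr fun p => ?_
  refine intervalIntegral.integral_congr fun b hb => ?_
  rw [uIcc_of_le p.2.2.1] at hb
  simp only [projIcc_of_mem zero_le_one ⟨hb.1, hb.2.trans p.2.2.2⟩]

/-- A slice of a function continuous on `J × [0,1]` is continuous on `[0,1]`. -/
lemma continuousOn_slice {J : Set ℝ} {φ : ℝ → ℝ → ℝ}
    (hφ : ContinuousOn (fun p : ℝ × ℝ => φ p.1 p.2) (J ×ˢ Icc (0:ℝ) 1)) {t : ℝ} (ht : t ∈ J) :
    ContinuousOn (φ t) (Icc (0:ℝ) 1) :=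
  hφ.comp (f := fun x => (t, x)) (by fun_prop) fun _ hx => ⟨ht, hx⟩

/-- A slice of a function continuous on `J × [0,1]` is continuous on `J`. -/
lemma continuousOn_slice_left {J : Set ℝ} {φ : ℝ → ℝ → ℝ}
    (hφ : ContinuousOn (fun p : ℝ × ℝ => φ p.1 p.2) (J ×ˢ Icc (0:ℝ) 1)) {x : ℝ}
    (hx : x ∈ Icc (0:ℝ) 1) : ContinuousOn (fun t => φ t x) J :=
  hφ.comp (f := fun t => (t, x)) (by fun_prop) fun _ ht => ⟨ht, hx⟩

lemma continuousOn_integral_param {J : Set ℝ} {φ : ℝ → ℝ → ℝ}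
    (hφ : ContinuousOn (fun p : ℝ × ℝ => φ p.1 p.2) (J ×ˢ Icc (0:ℝ) 1)) :
    ContinuousOn (fun t => ∫ b in (0:ℝ)..1, φ t b) J :=
  continuousOn_slice_left (φ := fun t x => ∫ b in (0:ℝ)..x, φ t b)
    (continuousOn_primitive_param hφ) ⟨zero_le_one, le_rfl⟩

lemma intervalIntegrable_of_continuousOn_unit {g : ℝ → ℝ} (hg : ContinuousOn g (Icc (0:ℝ) 1))
    {a : ℝ} (ha : a ∈ Icc (0:ℝ) 1) : IntervalIntegrable g volume 0 a :=
  (hg.mono (by rw [uIcc_of_le ha.1]; exact Icc_subset_Icc_right ha.2)).intervalIntegrable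

/-- Differentiation under the integral sign for a function which is `C¹` in time. -/
lemma hasDerivAt_integral_param {J : Set ℝ} {φ φt : ℝ → ℝ → ℝ}
    (hφ : ContinuousOn (fun p : ℝ × ℝ => φ p.1 p.2) (J ×ˢ Icc (0:ℝ) 1))
    (hφt : ContinuousOn (fun p : ℝ × ℝ => φt p.1 p.2) (J ×ˢ Icc (0:ℝ) 1))
    (hd : ∀ t ∈ J, ∀ x ∈ Icc (0:ℝ) 1, HasDerivAt (fun s => φ s x) (φt t x) t)
    {t a : ℝ} (ht : J ∈ 𝓝 t) (ha : a ∈ Icc (0:ℝ) 1) :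
    HasDerivAt (fun s => ∫ b in (0:ℝ)..a, φ s b) (∫ b in (0:ℝ)..a, φt t b) t := by
  obtain ⟨ε, hε, hJ⟩ := Metric.nhds_basis_closedBall.mem_iff.1 ht
  have hK : IsCompact (Metric.closedBall t ε ×ˢ Icc (0:ℝ) 1) :=
    (isCompact_closedBall t ε).prod isCompact_Icc
  obtain ⟨C, hC⟩ := hK.exists_bound_of_continuousOn (hφt.mono (prod_mono hJ Subset.rfl))
  have hsub : ∀ b ∈ uIoc 0 a, b ∈ Icc (0:ℝ) 1 := fun b hb => by
    rw [uIoc_of_le ha.1] at hb; exact ⟨hb.1.le, hb.2.trans ha.2⟩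
  have htJ : t ∈ J := mem_of_mem_nhds ht
  refine (intervalIntegral.hasDerivAt_integral_of_dominated_loc_of_deriv_le (bound := fun _ => C)
    (F := φ) (F' := φt) (Metric.closedBall_mem_nhds t hε) ?_ ?_ ?_ ?_ ?_ ?_).2
  · filter_upwards [ht] with s hs
    exact (intervalIntegrable_of_continuousOn_unit (continuousOn_slice hφ hs)
      ha).def'.aestronglyMeasurable
  · exact intervalIntegrable_of_continuousOn_unit (continuousOn_slice hφ htJ) ha
  · exact (intervalIntegrable_of_continuousOn_unit (continuousOn_slice hφt htJ)
      ha).def'.aestronglyMeasurable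
  · exact Eventually.of_forall fun b hb s hs => hC (s, b) ⟨hs, hsub b hb⟩
  · exact intervalIntegrable_const
  · exact Eventually.of_forall fun b hb s hs => hd s (hJ hs) b (hsub b hb)

lemma sq_le_integral_sq_deriv {u v : ℝ → ℝ} (hu : ∀ x ∈ Icc (0:ℝ) 1, HasDerivAt u (v x) x)
    (hv : ContinuousOn v (Icc (0:ℝ) 1)) (h0 : u 0 = 0) {x : ℝ} (hx : x ∈ Icc (0:ℝ) 1) :
    u x ^ 2 ≤ ∫ y in (0:ℝ)..1, v y ^ 2 := by
  have hi := intervalIntegrable_of_continuousOn_unit hv hx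
  have hi2 : IntervalIntegrable (fun y => v y ^ 2) volume 0 x :=
    intervalIntegrable_of_continuousOn_unit (hv.pow 2) hx
  have hi3 : IntervalIntegrable (fun y => v y ^ 2) volume 0 1 :=
    intervalIntegrable_of_continuousOn_unit (hv.pow 2) (a := 1) ⟨zero_le_one, le_rfl⟩
  have h1 : ∫ y in (0:ℝ)..x, v y = u x := by
    rw [intervalIntegral.integral_eq_sub_of_hasDerivAt (f := u) _ hi, h0, sub_zero]
    intro y hy
    rw [uIcc_of_le hx.1] at hy
    exact hu y ⟨hy.1, hy.2.trans hx.2⟩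
  have h2 : ∫ y in (0:ℝ)..x, 2 * u x * v y ≤ ∫ y in (0:ℝ)..x, (v y ^ 2 + u x ^ 2) := by
    refine intervalIntegral.integral_mono_on hx.1 (hi.const_mul _)
      (hi2.add intervalIntegrable_const) fun y _ => ?_
    nlinarith [sq_nonneg (v y - u x)]
  rw [intervalIntegral.integral_const_mul, h1,
    intervalIntegral.integral_add hi2 intervalIntegrable_const,
    intervalIntegral.integral_const, smul_eq_mul] at h2
  have h3 : ∫ y in (0:ℝ)..x, v y ^ 2 ≤ ∫ y in (0:ℝ)..1, v y ^ 2 :=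
    intervalIntegral.integral_mono_interval le_rfl hx.1 hx.2
      (Eventually.of_forall fun y => sq_nonneg _) hi3
  nlinarith [hx.1, hx.2, sq_nonneg (u x)]

lemma deriv_eq_of_eqOn_unit {u v : ℝ → ℝ} {u' v' x : ℝ} (h : ∀ y ∈ Icc (0:ℝ) 1, u y = v y)
    (hx : x ∈ Icc (0:ℝ) 1) (hu : HasDerivAt u u' x) (hv : HasDerivAt v v' x) : u' = v' :=
  (uniqueDiffOn_Icc_zero_one x hx).eq_deriv _
    (hu.hasDerivWithinAt (s := Icc (0:ℝ) 1))
    (hv.hasDerivWithinAt.congr h (h x hx))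

/-- The integrand of the time derivative of the squared distance between two solutions is, up to
an exact derivative and a multiple of `u_x`, controlled by that distance. -/
lemma energy_integrand_le {C f fx fxx fxt ρ ρt ρx g gx gxx gxt r rt rx c₁ c₂ : ℝ}
    (h1 : fxt + f * fxx - fx ^ 2 + ρ = c₁) (h2 : gxt + g * gxx - gx ^ 2 + r = c₂)
    (h3 : ρt + f * ρx = ρ * fx) (h4 : rt + g * rx = r * gx)
    (hfx : |fx| ≤ C) (hgx : |gx| ≤ C) (hgxx : |gxx| ≤ C) (hr : |r| ≤ C) (hrx : |rx| ≤ C) :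
    2 * (fx - gx) * (fxt - gxt) + 2 * (ρ - r) * (ρt - rt)
      + (fx * ((fx - gx) ^ 2 + (ρ - r) ^ 2)
        + f * (2 * (fx - gx) * (fxx - gxx) + 2 * (ρ - r) * (ρx - rx)))
      - 2 * (c₁ - c₂) * (fx - gx)
    ≤ (7 * C + 1) * ((fx - gx) ^ 2 + (ρ - r) ^ 2) + 2 * C * (f - g) ^ 2 := by
  have e1 : fxt = c₁ - f * fxx + fx ^ 2 - ρ := by linarith
  have e2 : gxt = c₂ - g * gxx + gx ^ 2 - r := by linarith
  have e3 : ρt = ρ * fx - f * ρx := by linarith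
  have e4 : rt = r * gx - g * rx := by linarith
  subst e1 e2 e3 e4
  obtain ⟨v, hv⟩ : ∃ v, v = fx - gx := ⟨_, rfl⟩
  obtain ⟨s, hs⟩ : ∃ s, s = ρ - r := ⟨_, rfl⟩
  obtain ⟨u, hu⟩ : ∃ u, u = f - g := ⟨_, rfl⟩
  have key : ∀ k p q : ℝ, |k| ≤ C → 2 * k * (p * q) ≤ C * (p ^ 2 + q ^ 2) := fun k p q hk => by
    rw [abs_le] at hk
    nlinarith [mul_nonneg (sub_nonneg.2 hk.2) (sq_nonneg (p + q)),
      mul_nonneg (by linarith [hk.1] : 0 ≤ C + k) (sq_nonneg (p - q))]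
  have k1 := key fx v v hfx
  have k2 := key gx v v hgx
  have k3 := key (-gxx) u v (by rwa [abs_neg])
  have k4 := key r v s hr
  have k5 := key (-rx) u s (by rwa [abs_neg])
  have k6 := key fx s s hfx
  have k7 : -2 * (s * v) ≤ s ^ 2 + v ^ 2 := by nlinarith [sq_nonneg (s + v)]
  have hC : 0 ≤ C := (abs_nonneg _).trans hfx
  rw [← hv, ← hs, ← hu]
  have : 2 * v * (c₁ - f * fxx + fx ^ 2 - ρ - (c₂ - g * gxx + gx ^ 2 - r))
      + 2 * s * (ρ * fx - f * ρx - (r * gx - g * rx))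
      + (fx * (v ^ 2 + s ^ 2) + f * (2 * v * (fxx - gxx) + 2 * s * (ρx - rx)))
      - 2 * (c₁ - c₂) * v =
      3 * (fx * (v * v)) + 2 * gx * (v * v) + 2 * (-gxx) * (u * v) + 2 * r * (v * s)
        + 2 * (-rx) * (u * s) + 3 * (fx * (s * s)) - 2 * (s * v) := by
    subst hv hs hu; ring
  rw [this]
  nlinarith [mul_nonneg hC (sq_nonneg v), mul_nonneg hC (sq_nonneg s)]

lemma timeSet_mem_of_le {T : ℝ≥0∞} {s t : ℝ} (ht : t ∈ timeSet T) (hs : s ∈ Icc 0 t) :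
    s ∈ timeSet T :=
  ⟨hs.1, (ENNReal.ofReal_le_ofReal hs.2).trans_lt ht.2⟩

/-- Classical solutions of the reduced Boussinesq system are determined by their initial data. -/
lemma IsClassicalSol.unique {T₁ T₂ : ℝ≥0∞} {f ρ fx fxx fxt ρt ρx g r gx gxx gxt rt rx : ℝ → ℝ → ℝ}
    (h₁ : IsClassicalSol T₁ f ρ fx fxx fxt ρt ρx) (h₂ : IsClassicalSol T₂ g r gx gxx gxt rt rx)
    (h0 : ∀ x ∈ Icc (0:ℝ) 1, f 0 x = g 0 x ∧ ρ 0 x = r 0 x) {t : ℝ}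
    (ht₁ : t ∈ timeSet T₁) (ht₂ : t ∈ timeSet T₂) :
    ∀ x ∈ Icc (0:ℝ) 1, f t x = g t x ∧ ρ t x = r t x := by
  have m₁ : ∀ s ∈ Icc 0 t, s ∈ timeSet T₁ := fun s hs => timeSet_mem_of_le ht₁ hs
  have m₂ : ∀ s ∈ Icc 0 t, s ∈ timeSet T₂ := fun s hs => timeSet_mem_of_le ht₂ hs
  have sub₁ : Icc 0 t ×ˢ Icc (0:ℝ) 1 ⊆ timeSet T₁ ×ˢ Icc (0:ℝ) 1 := prod_mono m₁ Subset.rfl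
  have sub₂ : Icc 0 t ×ˢ Icc (0:ℝ) 1 ⊆ timeSet T₂ ×ˢ Icc (0:ℝ) 1 := prod_mono m₂ Subset.rfl
  have cf := h₁.hcf.mono sub₁
  have cρ := h₁.hcρ.mono sub₁
  have cfx := h₁.hcfx.mono sub₁
  have cfxx := h₁.hcfxx.mono sub₁
  have cfxt := h₁.hcfxt.mono sub₁
  have cρt := h₁.hcρt.mono sub₁
  have cρx := h₁.hcρx.mono sub₁
  have cg := h₂.hcf.mono sub₂
  have cr := h₂.hcρ.mono sub₂
  have cgx := h₂.hcfx.mono sub₂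
  have cgxx := h₂.hcfxx.mono sub₂
  have cgxt := h₂.hcfxt.mono sub₂
  have crt := h₂.hcρt.mono sub₂
  have crx := h₂.hcρx.mono sub₂
  have hK : IsCompact (Icc 0 t ×ˢ Icc (0:ℝ) 1) := isCompact_Icc.prod isCompact_Icc
  obtain ⟨C₁, hC₁⟩ := hK.exists_bound_of_continuousOn cfx
  obtain ⟨C₂, hC₂⟩ := hK.exists_bound_of_continuousOn cgx
  obtain ⟨C₃, hC₃⟩ := hK.exists_bound_of_continuousOn cgxx
  obtain ⟨C₄, hC₄⟩ := hK.exists_bound_of_continuousOn cr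
  obtain ⟨C₅, hC₅⟩ := hK.exists_bound_of_continuousOn crx
  set C := max C₁ (max C₂ (max C₃ (max C₄ C₅))) with hC
  set e : ℝ → ℝ → ℝ := fun s x => (fx s x - gx s x) ^ 2 + (ρ s x - r s x) ^ 2 with he
  set e' : ℝ → ℝ → ℝ := fun s x => 2 * (fx s x - gx s x) * (fxt s x - gxt s x)
    + 2 * (ρ s x - r s x) * (ρt s x - rt s x) with he'
  have ce : ContinuousOn (fun p : ℝ × ℝ => e p.1 p.2) (Icc 0 t ×ˢ Icc (0:ℝ) 1) :=
    ((cfx.sub cgx).pow 2).add ((cρ.sub cr).pow 2)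
  have ce' : ContinuousOn (fun p : ℝ × ℝ => e' p.1 p.2) (Icc 0 t ×ˢ Icc (0:ℝ) 1) :=
    ((continuousOn_const.mul (cfx.sub cgx)).mul (cfxt.sub cgxt)).add
      ((continuousOn_const.mul (cρ.sub cr)).mul (cρt.sub crt))
  have hde : ∀ s ∈ Icc 0 t, ∀ x ∈ Icc (0:ℝ) 1, HasDerivAt (fun s => e s x) (e' s x) s := by
    intro s hs x hx
    have d1 := ((h₁.hfxt s (m₁ s hs) x hx).sub (h₂.hfxt s (m₂ s hs) x hx)).pow 2
    have d2 := ((h₁.hρt s (m₁ s hs) x hx).sub (h₂.hρt s (m₂ s hs) x hx)).pow 2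
    convert! d1.add d2 using 1
    simp [he']
  have hEc := continuousOn_integral_param ce
  have hone : (1:ℝ) ∈ Icc (0:ℝ) 1 := ⟨zero_le_one, le_rfl⟩
  have hzero : (0:ℝ) ∈ Icc (0:ℝ) 1 := ⟨le_rfl, zero_le_one⟩
  have hu : ∀ s ∈ Icc 0 t, ∀ x ∈ Icc (0:ℝ) 1,
      HasDerivAt (fun x => f s x - g s x) (fx s x - gx s x) x := fun s hs x hx =>
    (h₁.hfx s (m₁ s hs) x hx).sub (h₂.hfx s (m₂ s hs) x hx)
  have huE : ∀ s ∈ Icc 0 t, ∀ x ∈ Icc (0:ℝ) 1,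
      (f s x - g s x) ^ 2 ≤ ∫ y in (0:ℝ)..1, e s y := by
    intro s hs x hx
    have cv := continuousOn_slice (φ := fun s x => fx s x - gx s x) (cfx.sub cgx) hs
    refine (sq_le_integral_sq_deriv (hu s hs) cv ?_ hx).trans ?_
    · simp [(h₁.hbcf s (m₁ s hs)).1, (h₂.hbcf s (m₂ s hs)).1]
    · refine intervalIntegral.integral_mono_on zero_le_one
        (intervalIntegrable_of_continuousOn_unit (cv.pow 2) hone)
        (intervalIntegrable_of_continuousOn_unit (continuousOn_slice ce hs) hone) fun y _ => ?_
      have := sq_nonneg (ρ s y - r s y)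
      simp only [he]; linarith
  set K := 9 * C + 1 with hKdef
  have hE' : ∀ s ∈ Icc 0 t, ∫ y in (0:ℝ)..1, e' s y ≤ K * ∫ y in (0:ℝ)..1, e s y := by
    intro s hs
    set c := ((∫ y in (0:ℝ)..1, ρ s y) - 2 * ∫ y in (0:ℝ)..1, (fx s y) ^ 2)
      - ((∫ y in (0:ℝ)..1, r s y) - 2 * ∫ y in (0:ℝ)..1, (gx s y) ^ 2) with hc
    set q : ℝ → ℝ := fun x => fx s x * ((fx s x - gx s x) ^ 2 + (ρ s x - r s x) ^ 2)
        + f s x * (2 * (fx s x - gx s x) * (fxx s x - gxx s x)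
          + 2 * (ρ s x - r s x) * (ρx s x - rx s x)) with hq
    have cq : ContinuousOn q (Icc (0:ℝ) 1) := by
      have a1 := continuousOn_slice cfx hs
      have a2 := continuousOn_slice cgx hs
      have a3 := continuousOn_slice cρ hs
      have a4 := continuousOn_slice cr hs
      have a5 := continuousOn_slice cf hs
      have a6 := continuousOn_slice cfxx hs
      have a7 := continuousOn_slice cgxx hs
      have a8 := continuousOn_slice cρx hs
      have a9 := continuousOn_slice crx hs
      fun_prop
    have iq := intervalIntegrable_of_continuousOn_unit cq hone
    have iv := intervalIntegrable_of_continuousOn_unit (continuousOn_slice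
      (φ := fun s x => fx s x - gx s x) (cfx.sub cgx) hs) hone
    have ie := intervalIntegrable_of_continuousOn_unit (continuousOn_slice ce hs) hone
    have ie' := intervalIntegrable_of_continuousOn_unit (continuousOn_slice ce' hs) hone
    have Iq : ∫ x in (0:ℝ)..1, q x = 0 := by
      rw [intervalIntegral.integral_eq_sub_of_hasDerivAt
        (f := fun x => f s x * ((fx s x - gx s x) ^ 2 + (ρ s x - r s x) ^ 2)) _ iq]
      · simp [(h₁.hbcf s (m₁ s hs)).1, (h₁.hbcf s (m₁ s hs)).2]
      · intro x hx
        rw [uIcc_of_le zero_le_one] at hx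
        have d1 := ((h₁.hfxx s (m₁ s hs) x hx).sub (h₂.hfxx s (m₂ s hs) x hx)).pow 2
        have d2 := ((h₁.hρx s (m₁ s hs) x hx).sub (h₂.hρx s (m₂ s hs) x hx)).pow 2
        convert! (h₁.hfx s (m₁ s hs) x hx).mul (d1.add d2) using 1
        simp [hq]
    have Iv : ∫ x in (0:ℝ)..1, (fx s x - gx s x) = 0 := by
      rw [intervalIntegral.integral_eq_sub_of_hasDerivAt (f := fun x => f s x - g s x) _ iv]
      · simp [(h₁.hbcf s (m₁ s hs)).1, (h₁.hbcf s (m₁ s hs)).2, (h₂.hbcf s (m₂ s hs)).1,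
          (h₂.hbcf s (m₂ s hs)).2]
      · intro x hx
        rw [uIcc_of_le zero_le_one] at hx
        exact hu s hs x hx
    have hle : ∫ x in (0:ℝ)..1, (e' s x + q x - 2 * c * (fx s x - gx s x))
        ≤ ∫ x in (0:ℝ)..1, ((7 * C + 1) * e s x + 2 * C * ∫ y in (0:ℝ)..1, e s y) := by
      refine intervalIntegral.integral_mono_on zero_le_one ((ie'.add iq).sub (iv.const_mul _))
        ((ie.const_mul _).add intervalIntegrable_const) fun x hx => ?_
      have b1 := hC₁ (s, x) ⟨hs, hx⟩
      have b2 := hC₂ (s, x) ⟨hs, hx⟩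
      have b3 := hC₃ (s, x) ⟨hs, hx⟩
      have b4 := hC₄ (s, x) ⟨hs, hx⟩
      have b5 := hC₅ (s, x) ⟨hs, hx⟩
      simp only [Real.norm_eq_abs] at b1 b2 b3 b4 b5
      have hm := energy_integrand_le (C := C)
        (h₁.hpde1 s (m₁ s hs) x hx) (h₂.hpde1 s (m₂ s hs) x hx)
        (h₁.hpde2 s (m₁ s hs) x hx) (h₂.hpde2 s (m₂ s hs) x hx)
        (b1.trans (by simp [hC])) (b2.trans (by simp [hC])) (b3.trans (by simp [hC]))
        (b4.trans (by simp [hC])) (b5.trans (by simp [hC]))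
      have hC0 : 0 ≤ C := (abs_nonneg _).trans (b1.trans (by simp [hC]))
      have := mul_le_mul_of_nonneg_left (huE s hs x hx) hC0
      simp only [he', hq, hc]
      simp only [he] at this ⊢
      linarith
    rw [intervalIntegral.integral_sub (ie'.add iq) (iv.const_mul _),
      intervalIntegral.integral_add ie' iq, Iq, intervalIntegral.integral_const_mul, Iv,
      intervalIntegral.integral_add (ie.const_mul _) intervalIntegrable_const,
      intervalIntegral.integral_const_mul, intervalIntegral.integral_const] at hle
    simp only [smul_eq_mul] at hle
    rw [hKdef]
    linarith
  have ht0 : 0 ≤ t := ht₁.1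
  have hanti : AntitoneOn (fun s => (∫ y in (0:ℝ)..1, e s y) * Real.exp (-K * s)) (Icc 0 t) := by
    have hD : ∀ s ∈ Ioo 0 t, HasDerivAt
        (fun s => (∫ y in (0:ℝ)..1, e s y) * Real.exp (-K * s))
        ((∫ y in (0:ℝ)..1, e' s y) * Real.exp (-K * s)
          + (∫ y in (0:ℝ)..1, e s y) * (Real.exp (-K * s) * (-K * 1))) s := fun s hs =>
      (hasDerivAt_integral_param ce ce' hde (Icc_mem_nhds hs.1 hs.2) hone).mul
        (((hasDerivAt_id s).const_mul (-K)).exp)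
    refine antitoneOn_of_deriv_nonpos (convex_Icc 0 t) (hEc.mul (by fun_prop)) ?_ ?_
    · intro s hs
      rw [interior_Icc] at hs
      exact (hD s hs).differentiableAt.differentiableWithinAt
    · intro s hs
      rw [interior_Icc] at hs
      rw [(hD s hs).deriv]
      have := mul_nonneg (sub_nonneg.2 (hE' s (Ioo_subset_Icc_self hs)))
        (Real.exp_pos (-K * s)).le
      linarith
  have htt : t ∈ Icc 0 t := ⟨ht0, le_rfl⟩
  have h0t : (0:ℝ) ∈ Icc 0 t := ⟨le_rfl, ht0⟩
  have hE0 : ∫ y in (0:ℝ)..1, e 0 y = 0 := by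
    have : ∀ y ∈ uIcc (0:ℝ) 1, e 0 y = 0 := fun y hy => by
      rw [uIcc_of_le zero_le_one] at hy
      have := deriv_eq_of_eqOn_unit (fun y hy => (h0 y hy).1) hy
        (h₁.hfx 0 (m₁ 0 h0t) y hy) (h₂.hfx 0 (m₂ 0 h0t) y hy)
      simp [he, (h0 y hy).2, this]
    rw [intervalIntegral.integral_congr this]; simp
  have hEt : ∫ y in (0:ℝ)..1, e t y ≤ 0 := by
    have := hanti h0t htt ht0
    simp only [hE0, zero_mul] at this
    exact nonpos_of_mul_nonpos_left this (Real.exp_pos _)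
  have hez : ∀ x ∈ Icc (0:ℝ) 1, e t x = 0 := by
    intro x hx
    by_contra hne
    have hnn : ∀ y, 0 ≤ e t y := fun y => add_nonneg (sq_nonneg _) (sq_nonneg _)
    have := intervalIntegral.integral_pos zero_lt_one (continuousOn_slice ce htt)
      (fun y _ => hnn y) ⟨x, hx, lt_of_le_of_ne (hnn x) (Ne.symm hne)⟩
    linarith
  intro x hx
  have hx1 := huE t htt x hx
  have hx2 := hez x hx
  simp only [he] at hx2
  constructor
  · nlinarith [sq_nonneg (f t x - g t x)]
  · nlinarith [sq_nonneg (fx t x - gx t x), sq_nonneg (ρ t x - r t x)]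

lemma exists_second_order_solution_on_interval {Φ : ℝ → ℝ → ℝ} {K M : ℝ≥0}
    (hc : ∀ b, Continuous fun s => Φ s b) (hL : ∀ s, LipschitzWith K (Φ s))
    (hM : ∀ s b, |Φ s b| ≤ M) {N : ℝ≥0} (hN : 0 < N) :
    ∃ y : ℝ → ℝ × ℝ, y 0 = 0 ∧
      ∀ s ∈ Ioo (-N : ℝ) N, HasDerivAt y ((y s).2, Φ s (y s).1) s := by
  have hN' : (0:ℝ) < N := hN
  have hPL : IsPicardLindelof (fun s (y : ℝ × ℝ) => (y.2 / N, N * Φ s y.1))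
      (tmin := -N) (tmax := N) ⟨0, by simp⟩ 0 (N * (N * M)) 0 (N * M) (max (1 / N) (N * K)) := by
    refine ⟨fun s _ => LipschitzWith.lipschitzOnWith ?_, fun y _ => ?_, fun s _ y hy => ?_, ?_⟩
    · refine LipschitzWith.prodMk ?_ ?_
      · refine LipschitzWith.of_dist_le_mul fun y z => ?_
        rw [Real.dist_eq, ← sub_div, abs_div, abs_of_pos hN', div_eq_inv_mul]
        push_cast
        rw [one_div]
        exact mul_le_mul_of_nonneg_left
          (by rw [← Real.dist_eq, Prod.dist_eq]; exact le_max_right _ _)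
          (by positivity)
      · refine LipschitzWith.of_dist_le_mul fun y z => ?_
        rw [Real.dist_eq, ← mul_sub, abs_mul, abs_of_pos hN', ← Real.dist_eq]
        push_cast
        rw [mul_assoc]
        refine mul_le_mul_of_nonneg_left (((hL s).dist_le_mul _ _).trans ?_) hN'.le
        exact mul_le_mul_of_nonneg_left (by rw [Prod.dist_eq]; exact le_max_left _ _) K.2
    · have := hc y.1
      fun_prop
    · rw [mem_closedBall_zero_iff, Prod.norm_def, max_le_iff] at hy
      rw [Prod.norm_def, max_le_iff]
      push_cast at hy ⊢
      constructor
      · rw [Real.norm_eq_abs, abs_div, abs_of_pos hN', div_le_iff₀ hN']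
        have := hy.2
        rw [Real.norm_eq_abs] at this
        linarith
      · rw [Real.norm_eq_abs, abs_mul, abs_of_pos hN']
        exact mul_le_mul_of_nonneg_left (hM s y.1) hN'.le
    · simp
      nlinarith
  obtain ⟨α, hα0, hα⟩ := hPL.exists_eq_forall_mem_Icc_hasDerivWithinAt₀
  refine ⟨fun s => ((α s).1, (α s).2 / N), by simp_all, fun s hs => ?_⟩
  have h := (hα s (Ioo_subset_Icc_self hs)).hasDerivAt (Icc_mem_nhds hs.1 hs.2)
  have h1 : HasDerivAt (fun s => (α s).1) ((α s).2 / N) s :=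
    (hasFDerivAt_fst (𝕜 := ℝ) (p := α s)).comp_hasDerivAt s h
  have h2 : HasDerivAt (fun s => (α s).2) (N * Φ s (α s).1) s :=
    (hasFDerivAt_snd (𝕜 := ℝ) (p := α s)).comp_hasDerivAt s h
  have h3 := h2.div_const (N : ℝ)
  rw [mul_div_cancel_left₀ _ hN'.ne'] at h3
  exact h1.prodMk h3

/-- Global solvability of `b'' = Φ(s, b)`, `b(0) = b'(0) = 0`, for bounded Lipschitz `Φ`. -/
lemma exists_second_order_solution {Φ : ℝ → ℝ → ℝ} {K M : ℝ≥0}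
    (hc : ∀ b, Continuous fun s => Φ s b) (hL : ∀ s, LipschitzWith K (Φ s))
    (hM : ∀ s b, |Φ s b| ≤ M) :
    ∃ b g : ℝ → ℝ, b 0 = 0 ∧ g 0 = 0 ∧ (∀ s, HasDerivAt b (g s) s) ∧
      ∀ s, HasDerivAt g (Φ s (b s)) s := by
  have hv : ∀ s, LipschitzWith (max 1 K) (fun y : ℝ × ℝ => (y.2, Φ s y.1)) := fun s =>
    LipschitzWith.prodMk LipschitzWith.prod_snd
      (by
        have := (hL s).comp (LipschitzWith.prod_fst (α := ℝ) (β := ℝ))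
        rw [mul_one] at this
        exact this)
  choose y hy0 hy using fun n : ℕ =>
    exists_second_order_solution_on_interval hc hL hM (N := (n : ℝ≥0) + 1) (by positivity)
  have agree : ∀ m n : ℕ, m ≤ n → EqOn (y m) (y n) (Ioo (-((m:ℝ) + 1)) ((m:ℝ) + 1)) := by
    intro m n hmn
    have hmn' : (m:ℝ) ≤ n := by exact_mod_cast hmn
    refine ODE_solution_unique_of_mem_Ioo (v := fun s (y : ℝ × ℝ) => (y.2, Φ s y.1))
      (s := fun _ => univ) (t₀ := 0) (fun s _ => (hv s).lipschitzOnWith)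
      ⟨by linarith [m.cast_nonneg (α := ℝ)], by linarith [m.cast_nonneg (α := ℝ)]⟩
      (fun s hs => ⟨hy m s (by simpa using hs), trivial⟩)
      (fun s hs => ⟨hy n s ?_, trivial⟩) (by rw [hy0, hy0])
    push_cast
    exact ⟨by linarith [hs.1], by linarith [hs.2]⟩
  set Y : ℝ → ℝ × ℝ := fun s => y ⌈|s|⌉₊ s with hY
  have key : ∀ n : ℕ, EqOn Y (y n) (Ioo (-((n:ℝ) + 1)) ((n:ℝ) + 1)) := by
    intro n s hs
    have h1 : |s| < (⌈|s|⌉₊ : ℝ) + 1 := (Nat.le_ceil _).trans_lt (by linarith)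
    rcases le_total ⌈|s|⌉₊ n with h | h
    · exact agree _ _ h (abs_lt.1 h1)
    · exact (agree _ _ h hs).symm
  have hD : ∀ s, HasDerivAt Y ((Y s).2, Φ s (Y s).1) s := by
    intro s
    have h1 : s ∈ Ioo (-((⌈|s|⌉₊:ℝ) + 1)) ((⌈|s|⌉₊:ℝ) + 1) :=
      abs_lt.1 ((Nat.le_ceil _).trans_lt (by linarith))
    exact (hy _ s (by simpa using h1)).congr_of_eventuallyEq
      ((key _).eventuallyEq_of_mem (Ioo_mem_nhds h1.1 h1.2))
  refine ⟨fun s => (Y s).1, fun s => (Y s).2, by simp [hY, hy0], by simp [hY, hy0],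
    fun s => (hasFDerivAt_fst (𝕜 := ℝ) (p := Y s)).comp_hasDerivAt s (hD s),
    fun s => (hasFDerivAt_snd (𝕜 := ℝ) (p := Y s)).comp_hasDerivAt s (hD s)⟩

lemma nonneg_of_convex_deriv {b g φ : ℝ → ℝ} (hb0 : b 0 = 0) (hg0 : g 0 = 0)
    (hb : ∀ s, HasDerivAt b (g s) s) (hg : ∀ s, HasDerivAt g (φ s) s) (hφ : ∀ s, 0 ≤ φ s) :
    Monotone g ∧ ∀ s, 0 ≤ b s := by
  have hmono : Monotone g := monotone_of_deriv_nonneg (fun s => (hg s).differentiableAt)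
    fun s => by rw [(hg s).deriv]; exact hφ s
  have hbc : Continuous b := continuous_iff_continuousAt.2 fun s => (hb s).continuousAt
  refine ⟨hmono, fun s => ?_⟩
  rcases le_total 0 s with hs | hs
  · have : MonotoneOn b (Ici 0) := by
      refine monotoneOn_of_deriv_nonneg (convex_Ici 0) hbc.continuousOn
        (fun s _ => (hb s).differentiableAt.differentiableWithinAt) fun s hs => ?_
      rw [interior_Ici] at hs
      rw [(hb s).deriv, ← hg0]
      exact hmono hs.le
    rw [← hb0]
    exact this self_mem_Ici hs hs
  · have : AntitoneOn b (Iic 0) := by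
      refine antitoneOn_of_deriv_nonpos (convex_Iic 0) hbc.continuousOn
        (fun s _ => (hb s).differentiableAt.differentiableWithinAt) fun s hs => ?_
      rw [interior_Iic] at hs
      rw [(hb s).deriv, ← hg0]
      exact hmono hs.le
    rw [← hb0]
    exact this hs self_mem_Iic hs

/-- The reduced dynamics, with the clock given by the coefficient of `p`. -/
lemma exists_reduced_clock {p q : ℝ → ℝ} (hp : Continuous p) (hq : Continuous q)
    (hp0 : ∀ x, 0 ≤ p x) (hq0 : ∀ x, 0 ≤ q x) {δ Q : ℝ} (hδ : ∀ x, p x * δ ≤ 1 / 2)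
    (hQ : ∀ x, q x ≤ Q) :
    ∃ b g F : ℝ → ℝ, b 0 = 0 ∧ g 0 = 0 ∧ (∀ s, HasDerivAt b (g s) s) ∧
      (∀ s, HasDerivAt g (F s ^ 3) s) ∧ Continuous F ∧ (∀ s, 0 < F s) ∧
      (∀ s, 0 ≤ b s) ∧ Monotone g ∧
      ∀ s, -δ ≤ s → F s = ∫ x in (0:ℝ)..1, 1 / (1 + p x * s + q x * b s) := by
  have hden : ∀ s b x : ℝ, 1 / 2 ≤ 1 + p x * max s (-δ) + q x * max b 0 := fun s b x => by
    have h1 := mul_nonneg (hq0 x) (le_max_right b 0)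
    have h2 := mul_le_mul_of_nonneg_left (le_max_right s (-δ)) (hp0 x)
    linarith [hδ x]
  set H : ℝ → ℝ → ℝ → ℝ := fun s b x => 1 / (1 + p x * max s (-δ) + q x * max b 0) with hH
  have hHc : Continuous fun y : (ℝ × ℝ) × ℝ => H y.1.1 y.1.2 y.2 := by
    refine continuous_const.div (by fun_prop) fun y => ?_
    have := hden y.1.1 y.1.2 y.2
    exact (show (0:ℝ) < _ by linarith).ne'
  have hHcx : ∀ s b, Continuous (H s b) := fun s b =>
    hHc.comp (f := fun x => ((s, b), x)) (by fun_prop)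
  have hHi : ∀ s b, IntervalIntegrable (H s b) volume 0 1 := fun s b =>
    (hHcx s b).intervalIntegrable _ _
  have hHpos : ∀ s b x, 0 < H s b x := fun s b x =>
    one_div_pos.2 (by linarith [hden s b x])
  have hHle : ∀ s b x, H s b x ≤ 2 := fun s b x => by
    have := hden s b x
    rw [hH]; simp only
    rw [div_le_iff₀ (by linarith)]; linarith
  set Fh : ℝ → ℝ → ℝ := fun s b => ∫ x in (0:ℝ)..1, H s b x with hFh
  have hFc : Continuous fun y : ℝ × ℝ => Fh y.1 y.2 :=
    intervalIntegral.continuous_parametric_intervalIntegral_of_continuous'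
      (f := fun (y : ℝ × ℝ) x => H y.1 y.2 x) hHc 0 1
  have hFpos : ∀ s b, 0 < Fh s b := fun s b =>
    intervalIntegral.intervalIntegral_pos_of_pos (hHi s b) (hHpos s b) zero_lt_one
  have hFle : ∀ s b, Fh s b ≤ 2 := fun s b => by
    have := intervalIntegral.integral_mono_on zero_le_one (hHi s b)
      (intervalIntegrable_const (c := (2:ℝ))) fun x _ => hHle s b x
    simpa using this
  have hQ0 : 0 ≤ Q := (hq0 0).trans (hQ 0)
  have hFL : ∀ s b c, |Fh s b - Fh s c| ≤ 4 * Q * |b - c| := fun s b c => by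
    rw [hFh, ← intervalIntegral.integral_sub (hHi s b) (hHi s c)]
    have hpt : ∀ x, |H s b x - H s c x| ≤ 4 * Q * |b - c| := fun x => by
      have h1 := hden s b x
      have h2 := hden s c x
      have e : H s b x - H s c x = H s b x * H s c x * (q x * (max c 0 - max b 0)) := by
        simp only [hH]
        field_simp [show (1 + p x * max s (-δ) + q x * max b 0) ≠ 0 by linarith,
          show (1 + p x * max s (-δ) + q x * max c 0) ≠ 0 by linarith]
        ring
      rw [e, abs_mul, abs_mul, abs_mul, abs_of_pos (hHpos s b x), abs_of_pos (hHpos s c x),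
        abs_of_nonneg (hq0 x)]
      have h3 : |max c 0 - max b 0| ≤ |b - c| := by
        rw [abs_sub_comm b c]; exact abs_max_sub_max_le_abs c b 0
      have h4 : H s b x * H s c x ≤ 4 := by
        nlinarith [hHpos s b x, hHpos s c x, hHle s b x, hHle s c x]
      calc _ ≤ 4 * (Q * |b - c|) := by
            exact mul_le_mul h4 (mul_le_mul (hQ x) h3 (abs_nonneg _) hQ0)
              (mul_nonneg (hq0 x) (abs_nonneg _)) (by norm_num)
        _ = _ := by ring
    have := intervalIntegral.norm_integral_le_of_norm_le_const (a := 0) (b := 1)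
      (f := fun x => H s b x - H s c x) (C := 4 * Q * |b - c|) fun x _ => hpt x
    simpa using this
  obtain ⟨b, g, hb0, hg0, hb, hg⟩ := exists_second_order_solution
    (Φ := fun s b => Fh s b ^ 3) (K := (48 * Q).toNNReal) (M := 8)
    (fun b => (hFc.comp (f := fun s => (s, b)) (by fun_prop)).pow 3)
    (fun s => LipschitzWith.of_dist_le_mul fun x y => by
      rw [Real.dist_eq, Real.dist_eq, Real.coe_toNNReal _ (by positivity)]
      have e : Fh s x ^ 3 - Fh s y ^ 3 =
        (Fh s x ^ 2 + Fh s x * Fh s y + Fh s y ^ 2) * (Fh s x - Fh s y) := by ring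
      have hx := hFpos s x
      have hy := hFpos s y
      rw [e, abs_mul, abs_of_pos (by positivity)]
      have : Fh s x ^ 2 + Fh s x * Fh s y + Fh s y ^ 2 ≤ 12 := by
        nlinarith [hFle s x, hFle s y]
      calc _ ≤ 12 * (4 * Q * |x - y|) := by
            gcongr
            exact hFL s x y
        _ = _ := by ring)
    (fun s b => by
      rw [abs_of_pos (pow_pos (hFpos s b) 3)]
      have := pow_le_pow_left₀ (hFpos s b).le (hFle s b) 3
      norm_num at this ⊢
      exact this)
  have hbc : Continuous b := continuous_iff_continuousAt.2 fun s => (hb s).continuousAt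
  obtain ⟨hmono, hbnn⟩ := nonneg_of_convex_deriv hb0 hg0 hb hg
    fun s => (pow_pos (hFpos s (b s)) 3).le
  refine ⟨b, g, fun s => Fh s (b s), hb0, hg0, hb, hg, hFc.comp (f := fun s => (s, b s))
    (by fun_prop), fun s => hFpos s (b s), hbnn, hmono, fun s hs => ?_⟩
  simp only [hFh, hH, max_eq_left hs, max_eq_left (hbnn s)]

/-- Inversion of the clock `s ↦ ∫ r in 0..s, F r ^ 2`. -/
lemma exists_clock_inverse {F : ℝ → ℝ} (hF : Continuous F) (hpos : ∀ s, 0 < F s) {δ B : ℝ}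
    (hδ : 0 < δ) (hB : ∀ s, 0 ≤ s → ∫ r in (0:ℝ)..s, F r ^ 2 ≤ B) :
    ∃ (A : ℝ → ℝ) (t₀ t₁ : ℝ), t₀ < 0 ∧ 0 < t₁ ∧ A 0 = 0 ∧
      (∀ t ∈ Ioo t₀ t₁, -δ < A t ∧ HasDerivAt A (1 / F (A t) ^ 2) t) ∧
      (∀ t ∈ Ico 0 t₁, 0 ≤ A t) ∧ Tendsto A (𝓝[<] t₁) atTop := by
  set τ : ℝ → ℝ := fun s => ∫ r in (0:ℝ)..s, F r ^ 2 with hτ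
  have hc : Continuous fun r => F r ^ 2 := hF.pow 2
  have hd : ∀ s, HasDerivAt τ (F s ^ 2) s := fun s =>
    intervalIntegral.integral_hasDerivAt_right (hc.intervalIntegrable _ _)
      hc.stronglyMeasurable.stronglyMeasurableAtFilter hc.continuousAt
  have hmono : StrictMono τ := strictMono_of_deriv_pos fun s => by
    rw [(hd s).deriv]; exact pow_pos (hpos s) 2
  have hτc : Continuous τ := continuous_iff_continuousAt.2 fun s => (hd s).continuousAt
  have hτ0 : τ 0 = 0 := by simp [hτ]
  have hbdd : BddAbove (range τ) := ⟨B, by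
    rintro _ ⟨s, rfl⟩
    exact (hmono.monotone (le_max_left s 0)).trans (hB _ (le_max_right s 0))⟩
  set t₁ : ℝ := ⨆ s, τ s with ht₁
  have hlt : ∀ s, τ s < t₁ := fun s => (hmono (lt_add_one s)).trans_le (le_ciSup hbdd _)
  set A := Function.invFun τ with hA
  have hAτ : ∀ s, A (τ s) = s := Function.leftInverse_invFun hmono.injective
  have hτA : ∀ t ∈ Ioo (τ (-δ)) t₁, τ (A t) = t := fun t ht => by
    obtain ⟨s, hs⟩ := exists_lt_of_lt_ciSup ht.2
    have hle : -δ ≤ s := (hmono.lt_iff_lt.1 (ht.1.trans hs)).le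
    obtain ⟨r, -, hr⟩ := intermediate_value_Icc hle hτc.continuousOn ⟨ht.1.le, hs.le⟩
    rw [← hr, hAτ]
  have hAmono : StrictMonoOn A (Ioo (τ (-δ)) t₁) := fun x hx y hy hxy => by
    rw [← hmono.lt_iff_lt, hτA x hx, hτA y hy]; exact hxy
  have hAgt : ∀ t ∈ Ioo (τ (-δ)) t₁, -δ < A t := fun t ht => by
    rw [← hmono.lt_iff_lt, hτA t ht]; exact ht.1
  refine ⟨A, τ (-δ), t₁, ?_, ?_, ?_, fun t ht => ⟨hAgt t ht, ?_⟩, fun t ht => ?_, ?_⟩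
  · rw [← hτ0]; exact hmono (by linarith)
  · rw [← hτ0]; exact hlt 0
  · conv_lhs => rw [← hτ0]
    exact hAτ 0
  · have hnhds := Ioo_mem_nhds ht.1 ht.2
    have hcont : ContinuousAt A t :=
      hAmono.continuousAt_of_image_mem_nhds hnhds
        (mem_of_superset (Ioi_mem_nhds (hAgt t ht)) fun s hs =>
          ⟨τ s, ⟨hmono hs, hlt s⟩, hAτ s⟩)
    rw [one_div]
    exact (hd (A t)).of_local_left_inverse hcont (pow_pos (hpos _) 2).ne'
      (by filter_upwards [hnhds] with y hy using hτA y hy)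
  · have : t ∈ Ioo (τ (-δ)) t₁ :=
      ⟨lt_of_lt_of_le (by rw [← hτ0]; exact hmono (by linarith)) ht.1, ht.2⟩
    rw [← hmono.le_iff_le, hτA t this, hτ0]
    exact ht.1
  · refine tendsto_atTop.2 fun M => ?_
    have hM : τ (max M (-δ)) < t₁ := hlt _
    filter_upwards [Ioo_mem_nhdsLT hM] with t ht
    have : t ∈ Ioo (τ (-δ)) t₁ :=
      ⟨(hmono.monotone (le_max_right M (-δ))).trans_lt ht.1, ht.2⟩
    have h2 := ht.1
    rw [← hτA t this, hmono.lt_iff_lt] at h2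
    exact (le_max_left _ _).trans h2.le

/-- A function which vanishes exactly, and to first order, at the endpoints of `[0,1]`
dominates a parabola. -/
lemma exists_parabola_le {p : ℝ → ℝ} (hp : ContinuousOn p (Icc 0 1)) {a b : ℝ}
    (ha : 0 < a) (hb : 0 < b) (h0 : p 0 = 0) (h1 : p 1 = 0)
    (hd0 : HasDerivWithinAt p a (Icc 0 1) 0) (hd1 : HasDerivWithinAt p (-b) (Icc 0 1) 1)
    (hpos : ∀ x ∈ Ioo (0:ℝ) 1, 0 < p x) :
    ∃ c, 0 < c ∧ ∀ x ∈ Icc (0:ℝ) 1, c * (x * (1 - x)) ≤ p x := by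
  suffices h : ∃ c, 0 < c ∧ ∀ x ∈ Icc (0:ℝ) 1, x ∈ Icc (0:ℝ) 1 → c * (x * (1 - x)) ≤ p x by
    obtain ⟨c, hc, h⟩ := h
    exact ⟨c, hc, fun x hx => h x hx hx⟩
  refine (isCompact_Icc (a := (0:ℝ)) (b := 1)).induction_on
    (p := fun s => ∃ c, 0 < c ∧ ∀ x ∈ s, x ∈ Icc (0:ℝ) 1 → c * (x * (1 - x)) ≤ p x)
    ⟨1, one_pos, by simp⟩ ?_ ?_ ?_
  · rintro s t hst ⟨c, hc, h⟩
    exact ⟨c, hc, fun x hx => h x (hst hx)⟩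
  · rintro s t ⟨c, hc, h⟩ ⟨d, hd, h'⟩
    refine ⟨min c d, lt_min hc hd, fun x hx hI => ?_⟩
    have hx0 : 0 ≤ x * (1 - x) := mul_nonneg hI.1 (by linarith [hI.2])
    rcases hx with hx | hx
    · exact (mul_le_mul_of_nonneg_right (min_le_left _ _) hx0).trans (h x hx hI)
    · exact (mul_le_mul_of_nonneg_right (min_le_right _ _) hx0).trans (h' x hx hI)
  · intro x hx
    rcases eq_or_lt_of_le hx.1 with rfl | hx0
    · refine ⟨{y | ‖p y - p 0 - (y - 0) • a‖ ≤ a / 2 * ‖y - 0‖},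
        (hasDerivWithinAt_iff_isLittleO.1 hd0).def (half_pos ha), a / 2, half_pos ha,
        fun y hy hI => ?_⟩
      simp only [mem_ofPred_eq, h0, sub_zero, Real.norm_eq_abs, smul_eq_mul,
        abs_of_nonneg hI.1] at hy
      have := (abs_le.1 hy).1
      nlinarith [mul_nonneg ha.le (sq_nonneg y)]
    rcases eq_or_lt_of_le hx.2 with rfl | hx1
    · refine ⟨{y | ‖p y - p 1 - (y - 1) • (-b)‖ ≤ b / 2 * ‖y - 1‖},
        (hasDerivWithinAt_iff_isLittleO.1 hd1).def (half_pos hb), b / 2, half_pos hb,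
        fun y hy hI => ?_⟩
      simp only [mem_ofPred_eq, h1, sub_zero, Real.norm_eq_abs, smul_eq_mul,
        abs_of_nonpos (show y - 1 ≤ 0 by linarith [hI.2])] at hy
      have := (abs_le.1 hy).1
      nlinarith [mul_nonneg hb.le (sq_nonneg (1 - y))]
    · have hpx := hpos x ⟨hx0, hx1⟩
      refine ⟨{y | p x / 2 < p y}, (hp x hx).eventually_const_lt (half_lt_self hpx), p x / 2,
        half_pos hpx, fun y hy hI => ?_⟩
      have hy' : p x / 2 < p y := hy
      have : y * (1 - y) ≤ 1 := by nlinarith [sq_nonneg y, hI.2]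
      nlinarith

lemma exists_integral_one_div_le {p : ℝ → ℝ} (hp : ContinuousOn p (Icc 0 1)) {c : ℝ} (hc : 0 < c)
    (h : ∀ x ∈ Icc (0:ℝ) 1, c * (x * (1 - x)) ≤ p x) :
    ∃ C, ∀ s, 0 ≤ s → ∫ x in (0:ℝ)..1, 1 / (1 + p x * s) ≤ C * (1 + s) ^ (-(3/4) : ℝ) := by
  have hI1 : IntervalIntegrable (fun x : ℝ => x ^ (-(3/4) : ℝ)) volume 0 1 :=
    intervalIntegral.intervalIntegrable_rpow' (by norm_num)
  have hI2 : IntervalIntegrable (fun x : ℝ => (1 - x) ^ (-(3/4) : ℝ)) volume 0 1 := by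
    simpa using (hI1.comp_sub_left 1).symm
  set κ := min 1 c / 2 with hκ
  have hκ0 : 0 < κ := by positivity
  have hκ1 : 2 * κ ≤ 1 := by linarith [min_le_left 1 c]
  have hκc : 2 * κ ≤ c := by linarith [min_le_right 1 c]
  refine ⟨κ ^ (-(3/4) : ℝ) * ∫ x in (0:ℝ)..1, (x ^ (-(3/4) : ℝ) + (1 - x) ^ (-(3/4) : ℝ)),
    fun s hs => ?_⟩
  have hp0 : ∀ x ∈ Icc (0:ℝ) 1, 0 ≤ p x := fun x hx =>
    (mul_nonneg hc.le (mul_nonneg hx.1 (by linarith [hx.2]))).trans (h x hx)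
  have key : ∀ v y : ℝ, 0 < y → 1 ≤ v → κ * (1 + s) * y ≤ v →
      1 / v ≤ κ ^ (-(3/4) : ℝ) * (1 + s) ^ (-(3/4) : ℝ) * y ^ (-(3/4) : ℝ) := by
    intro v y hy hv hle
    have hs1 : 0 < 1 + s := by linarith
    rw [← Real.mul_rpow hκ0.le hs1.le, ← Real.mul_rpow (by positivity) hy.le,
      one_div, ← Real.rpow_neg_one]
    calc v ^ (-1 : ℝ) ≤ v ^ (-(3/4) : ℝ) := Real.rpow_le_rpow_of_exponent_le hv (by norm_num)
      _ ≤ _ := Real.rpow_le_rpow_of_nonpos (by positivity) hle (by norm_num)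
  rw [mul_right_comm, ← intervalIntegral.integral_const_mul]
  refine intervalIntegral.integral_mono_on_of_le_Ioo zero_le_one ?_
    ((hI1.add hI2).const_mul _) fun x hx => ?_
  · refine intervalIntegrable_of_continuousOn_unit ?_ ⟨zero_le_one, le_rfl⟩
    refine continuousOn_const.div (continuousOn_const.add (hp.mul continuousOn_const))
      fun x hx => ?_
    have := mul_nonneg (hp0 x hx) hs
    positivity
  · have hx' := Ioo_subset_Icc_self hx
    have hv : 1 ≤ 1 + p x * s := by linarith [mul_nonneg (hp0 x hx') hs]
    have hx0 : 0 ≤ x ^ (-(3/4) : ℝ) := Real.rpow_nonneg hx.1.le _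
    have hx1 : 0 ≤ (1 - x) ^ (-(3/4) : ℝ) := Real.rpow_nonneg (by linarith [hx.2]) _
    have hk : 0 ≤ κ ^ (-(3/4) : ℝ) * (1 + s) ^ (-(3/4) : ℝ) :=
      mul_nonneg (Real.rpow_nonneg hκ0.le _) (Real.rpow_nonneg (by linarith) _)
    have hlow : 2 * κ * (1 + s) * (x * (1 - x)) ≤ 1 + p x * s := by
      have h1 := mul_le_mul_of_nonneg_right (h x hx') hs
      have h2 : 0 ≤ x * (1 - x) := mul_nonneg hx.1.le (by linarith [hx.2])
      have h3 : x * (1 - x) ≤ 1 := by nlinarith [sq_nonneg x, hx.2]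
      have h4 := mul_le_mul_of_nonneg_right hκc (mul_nonneg h2 hs)
      nlinarith [mul_nonneg hκ0.le h2]
    have hks : 0 ≤ κ * (1 + s) := by positivity
    rcases le_total x (1 / 2) with hh | hh
    · refine (key _ x hx.1 hv (hlow.trans' ?_)).trans
        (mul_le_mul_of_nonneg_left (by linarith) hk)
      nlinarith [mul_nonneg (mul_nonneg hks hx.1.le) (show 0 ≤ 1 - 2 * x by linarith)]
    · refine (key _ (1 - x) (by linarith [hx.2]) hv (hlow.trans' ?_)).trans
        (mul_le_mul_of_nonneg_left (by linarith) hk)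
      nlinarith [mul_nonneg (mul_nonneg hks (show 0 ≤ 1 - x by linarith [hx.2]))
        (show 0 ≤ 2 * x - 1 by linarith)]

lemma integral_sq_le_of_decay {F : ℝ → ℝ} {C : ℝ} (hF : Continuous F) (h0 : ∀ s, 0 < F s)
    (h : ∀ s, 0 ≤ s → F s ≤ C * (1 + s) ^ (-(3/4) : ℝ)) {s : ℝ} (hs : 0 ≤ s) :
    ∫ r in (0:ℝ)..s, F r ^ 2 ≤ 2 * C ^ 2 := by
  have hd : ∀ r ∈ uIcc 0 s, HasDerivAt (fun r : ℝ => -2 * C ^ 2 * (1 + r) ^ (-(1/2) : ℝ))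
      (C ^ 2 * (1 + r) ^ (-(3/2) : ℝ)) r := by
    intro r hr
    rw [uIcc_of_le hs] at hr
    have := (((hasDerivAt_id r).const_add 1).rpow_const (p := (-(1/2) : ℝ))
      (Or.inl (by simp only [id]; linarith [hr.1]))).const_mul (-2 * C ^ 2)
    convert! this using 1
    norm_num
    ring
  have hc : ContinuousOn (fun r : ℝ => C ^ 2 * (1 + r) ^ (-(3/2) : ℝ)) (uIcc 0 s) := by
    refine continuousOn_const.mul ((continuousOn_const.add continuousOn_id).rpow_const
      fun r hr => Or.inl ?_)
    rw [uIcc_of_le hs] at hr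
    exact (show (0:ℝ) < 1 + r by linarith [hr.1]).ne'
  have hle : ∫ r in (0:ℝ)..s, F r ^ 2 ≤ ∫ r in (0:ℝ)..s, C ^ 2 * (1 + r) ^ (-(3/2) : ℝ) := by
    refine intervalIntegral.integral_mono_on hs ((hF.pow 2).intervalIntegrable _ _)
      hc.intervalIntegrable fun r hr => ?_
    have := pow_le_pow_left₀ (h0 r).le (h r hr.1) 2
    rw [mul_pow, ← Real.rpow_natCast (_ ^ _), ← Real.rpow_mul (by linarith [hr.1])] at this
    norm_num at this ⊢
    exact this
  rw [intervalIntegral.integral_eq_sub_of_hasDerivAt hd hc.intervalIntegrable] at hle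
  refine hle.trans ?_
  have := Real.rpow_nonneg (show 0 ≤ 1 + s by linarith) (-(1/2) : ℝ)
  simp only [add_zero, Real.one_rpow]
  nlinarith [sq_nonneg C]

/-- The reduced dynamics in physical time: it exists on an open interval around `0` and
degenerates, `w₀ → 0`, at the right endpoint. -/
lemma exists_reduced_solution {p q : ℝ → ℝ} (hp : Continuous p) (hq : Continuous q)
    (hp0 : ∀ x, 0 ≤ p x) (hq0 : ∀ x, 0 ≤ q x) {P Q c : ℝ} (hP : ∀ x, p x ≤ P)
    (hQ : ∀ x, q x ≤ Q) (hc : 0 < c) (hpc : ∀ x ∈ Icc (0:ℝ) 1, c * (x * (1 - x)) ≤ p x) :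
    ∃ (A B G w₀ : ℝ → ℝ) (t₀ t₁ : ℝ), t₀ < 0 ∧ 0 < t₁ ∧ A 0 = 0 ∧ B 0 = 0 ∧ G 0 = 0 ∧
      (∀ t ∈ Ioo t₀ t₁, HasDerivAt A (1 / w₀ t ^ 2) t ∧ HasDerivAt B (G t / w₀ t ^ 2) t ∧
        HasDerivAt G (w₀ t) t ∧ 0 < w₀ t ∧ (∀ x, 0 < 1 + p x * A t + q x * B t) ∧
        w₀ t = ∫ x in (0:ℝ)..1, 1 / (1 + p x * A t + q x * B t)) ∧
      (∀ t ∈ Ico 0 t₁, 0 ≤ G t) ∧ Tendsto w₀ (𝓝[<] t₁) (𝓝 0) := by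
  have hP0 : 0 ≤ P := (hp0 0).trans (hP 0)
  set δ := 1 / (2 * (P + 1)) with hδ
  have hδ0 : 0 < δ := by positivity
  have hpδ : ∀ x, p x * δ ≤ 1 / 2 := fun x => by
    rw [hδ, mul_one_div, div_le_div_iff₀ (by positivity) two_pos]
    linarith [hP x]
  obtain ⟨b, g, F, hb0, hg0, hb, hg, hFc, hFpos, hbnn, hgmono, hF⟩ :=
    exists_reduced_clock hp hq hp0 hq0 hpδ hQ
  obtain ⟨C, hC⟩ := exists_integral_one_div_le hp.continuousOn hc hpc
  have hbc : Continuous b := continuous_iff_continuousAt.2 fun s => (hb s).continuousAt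
  have hden : ∀ s, -δ < s → ∀ x, 0 < 1 + p x * s + q x * b s := fun s hs x => by
    have h1 := mul_nonneg (hq0 x) (hbnn s)
    have h2 := mul_le_mul_of_nonneg_left hs.le (hp0 x)
    linarith [hpδ x]
  have hFle : ∀ s, 0 ≤ s → F s ≤ C * (1 + s) ^ (-(3/4) : ℝ) := fun s hs => by
    have h1 : ∀ x, 0 < 1 + p x * s := fun x => by
      have := mul_nonneg (hp0 x) hs
      positivity
    have h2 := hden s (by linarith)
    rw [hF s (by linarith)]
    refine (intervalIntegral.integral_mono_on zero_le_one ?_ ?_ fun x _ => ?_).trans (hC s hs)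
    · exact (continuous_const.div (by fun_prop) fun x => (h2 x).ne').intervalIntegrable _ _
    · exact (continuous_const.div (by fun_prop) fun x => (h1 x).ne').intervalIntegrable _ _
    · exact one_div_le_one_div_of_le (h1 x) (by linarith [mul_nonneg (hq0 x) (hbnn s)])
  obtain ⟨A, t₀, t₁, ht₀, ht₁, hA0, hA, hAnn, hAtop⟩ :=
    exists_clock_inverse hFc hFpos hδ0 fun s hs => integral_sq_le_of_decay hFc hFpos hFle hs
  refine ⟨A, b ∘ A, g ∘ A, F ∘ A, t₀, t₁, ht₀, ht₁, hA0, by simp [hA0, hb0], by simp [hA0, hg0],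
    fun t ht => ?_, fun t ht => ?_, ?_⟩
  · obtain ⟨hAt, hAd⟩ := hA t ht
    have hne := (hFpos (A t)).ne'
    refine ⟨hAd, ?_, ?_, hFpos _, hden _ hAt, hF _ hAt.le⟩
    · convert! (hb (A t)).comp t hAd using 1
      simp only [Function.comp]
      ring
    · convert! (hg (A t)).comp t hAd using 1
      simp only [Function.comp]
      field_simp
  · rw [← hg0]
    exact hgmono (hAnn t ht)
  · refine Tendsto.comp (squeeze_zero' (Eventually.of_forall fun s => (hFpos s).le)
      ((eventually_ge_atTop 0).mono hFle) ?_) hAtop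
    rw [← mul_zero C]
    exact ((tendsto_rpow_neg_atTop (by norm_num)).comp
      (tendsto_atTop_add_const_left _ 1 tendsto_id)).const_mul C

lemma continuousOn_primitive_param_univ {J : Set ℝ} {φ : ℝ → ℝ → ℝ}
    (hφ : ContinuousOn (fun p : ℝ × ℝ => φ p.1 p.2) (J ×ˢ univ)) :
    ContinuousOn (fun p : ℝ × ℝ => ∫ b in (0:ℝ)..p.2, φ p.1 b) (J ×ˢ univ) := by
  have h1 : Continuous (Function.uncurry
      (fun (p : ↥(J ×ˢ (univ : Set ℝ))) (b : ℝ) => φ p.1.1 b)) :=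
    hφ.comp_continuous (f := fun q : ↥(J ×ˢ (univ : Set ℝ)) × ℝ => (q.1.1.1, q.2))
      (by fun_prop) fun q => ⟨q.1.2.1, mem_univ _⟩
  have h2 := intervalIntegral.continuous_parametric_intervalIntegral_of_continuous
    (μ := volume) (a₀ := (0:ℝ)) h1 (s := fun p : ↥(J ×ˢ (univ : Set ℝ)) => p.1.2) (by fun_prop)
  exact continuousOn_iff_continuous_domRestrict.2 h2

/-- A family of `C¹` functions whose time derivative is jointly continuous is differentiable in
time along any continuous choice of the space variable, once the static part is subtracted. -/
lemma hasDerivAt_sub_static {J K : Set ℝ} {Γ V : ℝ → ℝ → ℝ} {α : ℝ → ℝ} {t : ℝ} (hJ : J ∈ 𝓝 t)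
    (hV : ContinuousOn (fun y : ℝ × ℝ => V y.1 y.2) (J ×ˢ K))
    (hd : ∀ s ∈ J, ∀ a ∈ K, HasDerivAt (fun r => Γ r a) (V s a) s)
    (hαK : ∀ s ∈ J, α s ∈ K) (hα : ContinuousAt α t) :
    HasDerivAt (fun s => Γ s (α s) - Γ t (α s)) (V t (α t)) t := by
  rw [hasDerivAt_iff_isLittleO, Asymptotics.isLittleO_iff]
  intro ε hε
  have htJ := mem_of_mem_nhds hJ
  have h1 : ∀ᶠ y in 𝓝[J ×ˢ K] (t, α t), ‖V y.1 y.2 - V t (α t)‖ ≤ ε := by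
    have := (hV (t, α t) ⟨htJ, hαK t htJ⟩).eventually (Metric.closedBall_mem_nhds _ hε)
    filter_upwards [this] with y hy
    simpa [dist_eq_norm] using hy
  rw [nhdsWithin_prod_eq, eventually_prod_iff] at h1
  obtain ⟨pa, hpa, pb, hpb, hab⟩ := h1
  rw [nhdsWithin_eq_nhds.2 hJ] at hpa
  obtain ⟨r, hr, hball⟩ := Metric.eventually_nhds_iff_ball.1 (hpa.and hJ)
  have hαt : Tendsto α (𝓝 t) (𝓝[K] (α t)) :=
    tendsto_nhdsWithin_iff.2 ⟨hα, by filter_upwards [hJ] with s hs using hαK s hs⟩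
  filter_upwards [hαt.eventually hpb, Metric.ball_mem_nhds t hr, hJ] with s hs hsr hsJ
  have := (convex_ball t r).norm_image_sub_le_of_norm_hasDerivWithin_le
    (f := fun s' => Γ s' (α s) - s' * V t (α t)) (f' := fun s' => V s' (α s) - V t (α t))
    (C := ε) (x := t) (y := s)
    (fun s' hs' => (((hd s' (hball s' hs').2 (α s) (hαK s hsJ)).sub
      (hasDerivAt_mul_const _)).hasDerivWithinAt))
    (fun s' hs' => hab (hball s' hs').1 hs) (Metric.mem_ball_self hr) hsr
  refine le_trans (le_of_eq ?_) this
  congr 1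
  simp only [smul_eq_mul]
  ring

lemma exists_inverse_flow {t₀ t₁ : ℝ} {γ γt : ℝ → ℝ → ℝ}
    (hγ : ContinuousOn (fun y : ℝ × ℝ => γ y.1 y.2) (Ioo t₀ t₁ ×ˢ univ))
    (hγt : ContinuousOn (fun y : ℝ × ℝ => γt y.1 y.2) (Ioo t₀ t₁ ×ˢ Icc 0 1))
    (hd : ∀ t ∈ Ioo t₀ t₁, ∀ x ∈ Icc (0:ℝ) 1, HasDerivAt (fun s => γ s x) (γt t x) t)
    (hpos : ∀ t ∈ Ioo t₀ t₁, ∀ a, 0 < γ t a)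
    (h1 : ∀ t ∈ Ioo t₀ t₁, ∫ b in (0:ℝ)..1, γ t b = 1) :
    ∃ α : ℝ → ℝ → ℝ, ContinuousOn (fun y : ℝ × ℝ => α y.1 y.2) (Ioo t₀ t₁ ×ˢ Icc 0 1) ∧
      (∀ t ∈ Ioo t₀ t₁, ∀ a, α t (∫ b in (0:ℝ)..a, γ t b) = a) ∧
      ∀ t ∈ Ioo t₀ t₁, ∀ x ∈ Icc (0:ℝ) 1, α t x ∈ Icc (0:ℝ) 1 ∧
        HasDerivAt (α t) (1 / γ t (α t x)) x ∧
        HasDerivAt (fun s => α s x) (-(∫ b in (0:ℝ)..α t x, γt t b) / γ t (α t x)) t := by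
  set Γ : ℝ → ℝ → ℝ := fun t a => ∫ b in (0:ℝ)..a, γ t b with hΓ
  have hγc : ∀ t ∈ Ioo t₀ t₁, Continuous (γ t) := fun t ht =>
    hγ.comp_continuous (f := fun x => (t, x)) (by fun_prop) fun x => ⟨ht, mem_univ _⟩
  have hΓd : ∀ t ∈ Ioo t₀ t₁, ∀ a, HasDerivAt (Γ t) (γ t a) a := fun t ht a =>
    intervalIntegral.integral_hasDerivAt_right ((hγc t ht).intervalIntegrable _ _)
      (hγc t ht).stronglyMeasurable.stronglyMeasurableAtFilter (hγc t ht).continuousAt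
  have hmono : ∀ t ∈ Ioo t₀ t₁, StrictMono (Γ t) := fun t ht =>
    strictMono_of_deriv_pos fun a => by rw [(hΓd t ht a).deriv]; exact hpos t ht a
  have hΓc : ∀ t ∈ Ioo t₀ t₁, Continuous (Γ t) := fun t ht =>
    continuous_iff_continuousAt.2 fun a => (hΓd t ht a).continuousAt
  have hΓ0 : ∀ t, Γ t 0 = 0 := fun t => by simp [hΓ]
  have hΓcont := continuousOn_primitive_param_univ hγ
  set α : ℝ → ℝ → ℝ := fun t => Function.invFun (Γ t) with hα
  have hαΓ : ∀ t ∈ Ioo t₀ t₁, ∀ a, α t (Γ t a) = a := fun t ht =>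
    Function.leftInverse_invFun (hmono t ht).injective
  have hmem : ∀ t ∈ Ioo t₀ t₁, ∀ x ∈ Icc (0:ℝ) 1, α t x ∈ Icc (0:ℝ) 1 ∧ Γ t (α t x) = x := by
    intro t ht x hx
    obtain ⟨a, ha, rfl⟩ := intermediate_value_Icc zero_le_one (hΓc t ht).continuousOn
      (show x ∈ Icc (Γ t 0) (Γ t 1) by rwa [hΓ0, show Γ t 1 = 1 from h1 t ht])
    rw [hαΓ t ht]
    exact ⟨ha, rfl⟩
  have hαc : ContinuousOn (fun y : ℝ × ℝ => α y.1 y.2) (Ioo t₀ t₁ ×ˢ Icc 0 1) := by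
    rintro ⟨t, x⟩ ⟨ht, hx⟩
    have hΓt : ∀ a, Tendsto (fun y : ℝ × ℝ => Γ y.1 a) (𝓝[Ioo t₀ t₁ ×ˢ Icc 0 1] (t, x))
        (𝓝 (Γ t a)) := fun a =>
      (hΓcont.comp (f := fun y : ℝ × ℝ => (y.1, a)) (by fun_prop)
        (fun y hy => ⟨hy.1, mem_univ _⟩) : ContinuousOn _ (Ioo t₀ t₁ ×ˢ Icc (0:ℝ) 1))
          (t, x) ⟨ht, hx⟩
    have hsnd : Tendsto (fun y : ℝ × ℝ => y.2) (𝓝[Ioo t₀ t₁ ×ˢ Icc 0 1] (t, x)) (𝓝 x) :=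
      (continuous_snd.tendsto _).mono_left nhdsWithin_le_nhds
    refine tendsto_order.2 ⟨fun a ha => ?_, fun a ha => ?_⟩
    · have : Γ t a < x := by
        rw [← (hmem t ht x hx).2]; exact hmono t ht ha
      filter_upwards [(hΓt a).eventually_lt hsnd this, self_mem_nhdsWithin] with y hy hyJ
      rw [← (hmono y.1 hyJ.1).lt_iff_lt, (hmem y.1 hyJ.1 y.2 hyJ.2).2]
      exact hy
    · have : x < Γ t a := by
        rw [← (hmem t ht x hx).2]; exact hmono t ht ha
      filter_upwards [hsnd.eventually_lt (hΓt a) this, self_mem_nhdsWithin] with y hy hyJ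
      rw [← (hmono y.1 hyJ.1).lt_iff_lt, (hmem y.1 hyJ.1 y.2 hyJ.2).2]
      exact hy
  refine ⟨α, hαc, hαΓ, fun t ht x hx => ?_⟩
  obtain ⟨hαI, hΓα⟩ := hmem t ht x hx
  have hJ : Ioo t₀ t₁ ∈ 𝓝 t := Ioo_mem_nhds ht.1 ht.2
  have hαx : HasDerivAt (α t) (1 / γ t (α t x)) x := by
    rw [one_div]
    have hlt : Γ t (-1) < x := ((hmono t ht) (by norm_num)).trans_le ((hΓ0 t).trans_le hx.1)
    have hgt : x < Γ t 2 := hx.2.trans_lt (by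
      rw [← h1 t ht]; exact hmono t ht one_lt_two)
    have hright : ∀ y ∈ Ioo (Γ t (-1)) (Γ t 2), Γ t (α t y) = y := fun y hy => by
      obtain ⟨a, -, rfl⟩ := intermediate_value_Icc (by norm_num : (-1:ℝ) ≤ 2)
        (hΓc t ht).continuousOn (Ioo_subset_Icc_self hy)
      rw [hαΓ t ht]
    have hnhds := Ioo_mem_nhds hlt hgt
    have hm : StrictMonoOn (α t) (Ioo (Γ t (-1)) (Γ t 2)) := fun y hy z hz hyz => by
      rw [← (hmono t ht).lt_iff_lt, hright y hy, hright z hz]; exact hyz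
    refine (hΓd t ht _).of_local_left_inverse
      (hm.continuousAt_of_image_mem_nhds hnhds ?_) (hpos t ht _).ne'
      (by filter_upwards [hnhds] with y hy using hright y hy)
    refine mem_of_superset (Ioo_mem_nhds (a := -1) (b := 2) (by linarith [hαI.1])
      (by linarith [hαI.2])) fun a ha => ⟨Γ t a, ⟨hmono t ht ha.1, hmono t ht ha.2⟩, hαΓ t ht a⟩
  refine ⟨hαI, hαx, ?_⟩
  have hαt : ContinuousAt (fun s => α s x) t :=
    (continuousOn_slice_left hαc hx).continuousAt hJ
  have hstat := hasDerivAt_sub_static (Γ := Γ) (V := fun s a => ∫ b in (0:ℝ)..a, γt s b)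
    (α := fun s => α s x) hJ (continuousOn_primitive_param hγt)
    (fun s hs a ha => hasDerivAt_integral_param (hγ.mono (prod_mono Subset.rfl (subset_univ _)))
      hγt hd (Ioo_mem_nhds hs.1 hs.2) ha) (fun s hs => (hmem s hs x hx).1) hαt
  have hin := hstat.const_sub x
  have hcomp := HasDerivAt.comp t (h₂ := α t) (h₂' := 1 / γ t (α t x)) (by simpa using hαx) hin
  refine (hcomp.congr_of_eventuallyEq ?_).congr_deriv (by ring)
  filter_upwards [hJ] with s hs
  simp only [Function.comp]
  rw [(hmem s hs x hx).2, sub_sub_cancel, hαΓ t ht]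

/-- Chain rule along a curve, with a one-sided space derivative. -/
lemma hasDerivAt_along_curve {J K : Set ℝ} {u ut : ℝ → ℝ → ℝ} {α : ℝ → ℝ} {ua α' t : ℝ}
    (hJ : J ∈ 𝓝 t) (hut : ContinuousOn (fun y : ℝ × ℝ => ut y.1 y.2) (J ×ˢ K))
    (hd : ∀ s ∈ J, ∀ a ∈ K, HasDerivAt (fun r => u r a) (ut s a) s)
    (hαK : ∀ s ∈ J, α s ∈ K) (hα : HasDerivAt α α' t)
    (hua : HasDerivWithinAt (u t) ua K (α t)) :
    HasDerivAt (fun s => u s (α s)) (ut t (α t) + ua * α') t := by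
  have h1 := hasDerivAt_sub_static hJ hut hd hαK hα.continuousAt
  have h2 : HasDerivAt (fun s => u t (α s)) (ua * α') t := by
    have := hua.comp t (hα.hasDerivWithinAt (s := J)) hαK
    exact this.hasDerivAt hJ
  exact (h1.add h2).congr_of_eventuallyEq (Eventually.of_forall fun s => by simp)

/-- A solution of the reduced Boussinesq system on `J × [0,1]`, with one-sided space derivatives
at the endpoints. -/
structure IsSolWithin (J : Set ℝ) (f ρ fx fxx fxt ρt ρx : ℝ → ℝ → ℝ) : Prop where
  hfx : ∀ t ∈ J, ∀ x ∈ Icc (0:ℝ) 1, HasDerivWithinAt (f t) (fx t x) (Icc 0 1) x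
  hfxx : ∀ t ∈ J, ∀ x ∈ Icc (0:ℝ) 1, HasDerivWithinAt (fx t) (fxx t x) (Icc 0 1) x
  hfxt : ∀ t ∈ J, ∀ x ∈ Icc (0:ℝ) 1, HasDerivAt (fun s => fx s x) (fxt t x) t
  hρt : ∀ t ∈ J, ∀ x ∈ Icc (0:ℝ) 1, HasDerivAt (fun s => ρ s x) (ρt t x) t
  hρx : ∀ t ∈ J, ∀ x ∈ Icc (0:ℝ) 1, HasDerivWithinAt (ρ t) (ρx t x) (Icc 0 1) x
  hcfx : ContinuousOn (fun p : ℝ × ℝ => fx p.1 p.2) (J ×ˢ Icc (0:ℝ) 1)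
  hcfxx : ContinuousOn (fun p : ℝ × ℝ => fxx p.1 p.2) (J ×ˢ Icc (0:ℝ) 1)
  hcfxt : ContinuousOn (fun p : ℝ × ℝ => fxt p.1 p.2) (J ×ˢ Icc (0:ℝ) 1)
  hcf : ContinuousOn (fun p : ℝ × ℝ => f p.1 p.2) (J ×ˢ Icc (0:ℝ) 1)
  hcρ : ContinuousOn (fun p : ℝ × ℝ => ρ p.1 p.2) (J ×ˢ Icc (0:ℝ) 1)
  hcρt : ContinuousOn (fun p : ℝ × ℝ => ρt p.1 p.2) (J ×ˢ Icc (0:ℝ) 1)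
  hcρx : ContinuousOn (fun p : ℝ × ℝ => ρx p.1 p.2) (J ×ˢ Icc (0:ℝ) 1)
  hpde1 : ∀ t ∈ J, ∃ c, ∀ x ∈ Icc (0:ℝ) 1,
    fxt t x + f t x * fxx t x - (fx t x) ^ 2 + ρ t x = c
  hpde2 : ∀ t ∈ J, ∀ x ∈ Icc (0:ℝ) 1, ρt t x + f t x * ρx t x = ρ t x * fx t x
  hbcf : ∀ t ∈ J, f t 0 = 0 ∧ f t 1 = 0
  hbcρ : ∀ t ∈ J, ρ t 0 = 0 ∧ ρ t 1 = 0

lemma integral_deriv_unit {u v : ℝ → ℝ}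
    (h : ∀ x ∈ Icc (0:ℝ) 1, HasDerivWithinAt u (v x) (Icc 0 1) x)
    (hv : ContinuousOn v (Icc 0 1)) : ∫ x in (0:ℝ)..1, v x = u 1 - u 0 :=
  intervalIntegral.integral_eq_sub_of_hasDerivAt_of_le zero_le_one
    (fun x hx => (h x hx).continuousWithinAt)
    (fun x hx => (h x (Ioo_subset_Icc_self hx)).hasDerivAt (Icc_mem_nhds hx.1 hx.2))
    (intervalIntegrable_of_continuousOn_unit hv ⟨zero_le_one, le_rfl⟩)

/-- The spatially constant pressure term is determined by the boundary conditions. -/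
lemma IsSolWithin.pressure {J : Set ℝ} {f ρ fx fxx fxt ρt ρx : ℝ → ℝ → ℝ} (hJ : IsOpen J)
    (h : IsSolWithin J f ρ fx fxx fxt ρt ρx) {t : ℝ} (ht : t ∈ J) {x : ℝ}
    (hx : x ∈ Icc (0:ℝ) 1) :
    fxt t x + f t x * fxx t x - (fx t x) ^ 2 + ρ t x
      = (∫ y in (0:ℝ)..1, ρ t y) - 2 * ∫ y in (0:ℝ)..1, (fx t y) ^ 2 := by
  obtain ⟨c, hc⟩ := h.hpde1 t ht
  have one : (1:ℝ) ∈ Icc (0:ℝ) 1 := ⟨zero_le_one, le_rfl⟩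
  have cf := continuousOn_slice h.hcf ht
  have cfx := continuousOn_slice h.hcfx ht
  have cfxx := continuousOn_slice h.hcfxx ht
  have cfxt := continuousOn_slice h.hcfxt ht
  have cρ := continuousOn_slice h.hcρ ht
  have hfxt0 : ∫ y in (0:ℝ)..1, fxt t y = 0 := by
    refine (hasDerivAt_integral_param h.hcfx h.hcfxt h.hfxt (hJ.mem_nhds ht) one).unique ?_
    refine (hasDerivAt_const t (0:ℝ)).congr_of_eventuallyEq ?_
    filter_upwards [hJ.mem_nhds ht] with s hs
    rw [integral_deriv_unit (h.hfx s hs) (continuousOn_slice h.hcfx hs), (h.hbcf s hs).1,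
      (h.hbcf s hs).2, sub_zero]
  have hparts : ∫ y in (0:ℝ)..1, (fx t y * fx t y + f t y * fxx t y) = 0 := by
    rw [integral_deriv_unit (u := fun y => f t y * fx t y)
      (fun y hy => (h.hfx t ht y hy).mul (h.hfxx t ht y hy))
      ((cfx.mul cfx).add (cf.mul cfxx))]
    simp [(h.hbcf t ht).1, (h.hbcf t ht).2]
  have hci : ∫ y in (0:ℝ)..1, (fxt t y + (fx t y * fx t y + f t y * fxx t y) + ρ t y
      - 2 * fx t y ^ 2) = c := by
    rw [intervalIntegral.integral_congr (g := fun _ => c)]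
    · simp
    · intro y hy
      rw [uIcc_of_le zero_le_one] at hy
      simp only
      rw [← hc y hy]
      ring
  have hi := fun {g : ℝ → ℝ} (hg : ContinuousOn g (Icc (0:ℝ) 1)) =>
    intervalIntegrable_of_continuousOn_unit hg one
  have i₁ : IntervalIntegrable (fun y => fx t y * fx t y + f t y * fxx t y) volume 0 1 :=
    hi ((cfx.mul cfx).add (cf.mul cfxx))
  have i₂ : IntervalIntegrable (fun y => 2 * fx t y ^ 2) volume 0 1 :=
    hi (continuousOn_const.mul (cfx.pow 2))
  rw [intervalIntegral.integral_sub (((hi cfxt).add i₁).add (hi cρ)) i₂,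
    intervalIntegral.integral_add ((hi cfxt).add i₁) (hi cρ),
    intervalIntegral.integral_add (hi cfxt) i₁,
    hfxt0, hparts, intervalIntegral.integral_const_mul] at hci
  rw [hc x hx, ← hci]
  ring

/-- Affine extension across the endpoints of `[0,1]`, with prescribed slopes. -/
noncomputable def unitExtend (u v : ℝ → ℝ) (x : ℝ) : ℝ :=
  u (projIcc 0 1 zero_le_one x) + v (projIcc 0 1 zero_le_one x) * (x - projIcc 0 1 zero_le_one x)

lemma unitExtend_of_mem {u v : ℝ → ℝ} {x : ℝ} (hx : x ∈ Icc (0:ℝ) 1) :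
    unitExtend u v x = u x := by
  simp [unitExtend, projIcc_of_mem zero_le_one hx]

lemma hasDerivAt_unitExtend {u v : ℝ → ℝ} {x : ℝ} (hx : x ∈ Icc (0:ℝ) 1)
    (h : HasDerivWithinAt u (v x) (Icc 0 1) x) : HasDerivAt (unitExtend u v) (v x) x := by
  have hI : HasDerivWithinAt (unitExtend u v) (v x) (Icc 0 1) x :=
    h.congr (fun y hy => unitExtend_of_mem hy) (unitExtend_of_mem hx)
  have aff : ∀ a c : ℝ, HasDerivAt (fun y => c + v x * (y - a)) (v x) x := fun a c => by
    simpa using (((hasDerivAt_id x).sub_const a).const_mul (v x)).const_add c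
  rcases eq_or_lt_of_le hx.1 with rfl | hx0
  · have hl : HasDerivWithinAt (unitExtend u v) (v 0) (Iic 0) 0 :=
      (aff 0 (u 0)).hasDerivWithinAt.congr_of_mem
        (fun y hy => by simp [unitExtend, projIcc_of_le_left zero_le_one (mem_Iic.1 hy)])
        self_mem_Iic
    have := hl.union hI
    rw [Iic_union_Icc_eq_Iic zero_le_one] at this
    exact this.hasDerivAt (Iic_mem_nhds zero_lt_one)
  rcases eq_or_lt_of_le hx.2 with rfl | hx1
  · have hr : HasDerivWithinAt (unitExtend u v) (v 1) (Ici 1) 1 :=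
      (aff 1 (u 1)).hasDerivWithinAt.congr_of_mem
        (fun y hy => by simp [unitExtend, projIcc_of_right_le zero_le_one (mem_Ici.1 hy)])
        self_mem_Ici
    have := hI.union hr
    rw [Icc_union_Ici_eq_Ici zero_le_one] at this
    exact this.hasDerivAt (Ici_mem_nhds zero_lt_one)
  · exact hI.hasDerivAt (Icc_mem_nhds hx0 hx1)

/-- One-sided solutions on an open set of times give classical solutions. -/
lemma IsSolWithin.isClassicalSol {J : Set ℝ} {f ρ fx fxx fxt ρt ρx : ℝ → ℝ → ℝ} (hJ : IsOpen J)
    (h : IsSolWithin J f ρ fx fxx fxt ρt ρx) {T : ℝ≥0∞} (hT : timeSet T ⊆ J) :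
    IsClassicalSol T (fun t => unitExtend (f t) (fx t)) (fun t => unitExtend (ρ t) (ρx t))
      (fun t => unitExtend (fx t) (fxx t)) fxx fxt ρt ρx := by
  have congrOn : ∀ {φ ψ : ℝ → ℝ → ℝ},
      ContinuousOn (fun p : ℝ × ℝ => φ p.1 p.2) (J ×ˢ Icc (0:ℝ) 1) →
      ContinuousOn (fun p : ℝ × ℝ => unitExtend (φ p.1) (ψ p.1) p.2)
        (timeSet T ×ˢ Icc (0:ℝ) 1) := fun hφ =>
    (hφ.mono (prod_mono hT Subset.rfl)).congr fun p hp => unitExtend_of_mem hp.2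
  have m0 : (0:ℝ) ∈ Icc (0:ℝ) 1 := ⟨le_rfl, zero_le_one⟩
  have m1 : (1:ℝ) ∈ Icc (0:ℝ) 1 := ⟨zero_le_one, le_rfl⟩
  refine ⟨fun t ht x hx => ?_, fun t ht x hx => hasDerivAt_unitExtend hx (h.hfxx t (hT ht) x hx),
    fun t ht x hx => ?_, fun t ht x hx => ?_,
    fun t ht x hx => hasDerivAt_unitExtend hx (h.hρx t (hT ht) x hx),
    congrOn h.hcf, congrOn h.hcρ, congrOn h.hcfx, h.hcfxx.mono (prod_mono hT Subset.rfl),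
    h.hcfxt.mono (prod_mono hT Subset.rfl), h.hcρt.mono (prod_mono hT Subset.rfl),
    h.hcρx.mono (prod_mono hT Subset.rfl), fun t ht x hx => ?_, fun t ht x hx => ?_,
    fun t ht => ?_, fun t ht => ?_⟩
  · rw [unitExtend_of_mem hx]
    exact hasDerivAt_unitExtend hx (h.hfx t (hT ht) x hx)
  · simpa only [unitExtend_of_mem hx] using h.hfxt t (hT ht) x hx
  · simpa only [unitExtend_of_mem hx] using h.hρt t (hT ht) x hx
  · rw [unitExtend_of_mem hx, unitExtend_of_mem hx, unitExtend_of_mem hx,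
      h.pressure hJ (hT ht) hx]
    congr 1
    · refine intervalIntegral.integral_congr fun y hy => ?_
      rw [uIcc_of_le zero_le_one] at hy
      simp only [unitExtend_of_mem hy]
    · congr 1
      refine intervalIntegral.integral_congr fun y hy => ?_
      rw [uIcc_of_le zero_le_one] at hy
      simp only [unitExtend_of_mem hy]
  · simpa only [unitExtend_of_mem hx] using h.hpde2 t (hT ht) x hx
  · simpa only [unitExtend_of_mem m0, unitExtend_of_mem m1] using h.hbcf t (hT ht)
  · simpa only [unitExtend_of_mem m0, unitExtend_of_mem m1] using h.hbcρ t (hT ht)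

/-- A solution of the reduced Boussinesq system from its Lagrangian description: `γ` is the
Jacobian of the inverse flow, `h` and `r` are `f_x` and `ρ` along trajectories. -/
lemma exists_isSolWithin_of_lagrangian {t₀ t₁ : ℝ} {γ h ha ht r ra rt : ℝ → ℝ → ℝ}
    (cγ : ContinuousOn (fun y : ℝ × ℝ => γ y.1 y.2) (Ioo t₀ t₁ ×ˢ univ))
    (ch : ContinuousOn (fun y : ℝ × ℝ => h y.1 y.2) (Ioo t₀ t₁ ×ˢ Icc 0 1))
    (cha : ContinuousOn (fun y : ℝ × ℝ => ha y.1 y.2) (Ioo t₀ t₁ ×ˢ Icc 0 1))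
    (cht : ContinuousOn (fun y : ℝ × ℝ => ht y.1 y.2) (Ioo t₀ t₁ ×ˢ Icc 0 1))
    (cr : ContinuousOn (fun y : ℝ × ℝ => r y.1 y.2) (Ioo t₀ t₁ ×ˢ Icc 0 1))
    (cra : ContinuousOn (fun y : ℝ × ℝ => ra y.1 y.2) (Ioo t₀ t₁ ×ˢ Icc 0 1))
    (crt : ContinuousOn (fun y : ℝ × ℝ => rt y.1 y.2) (Ioo t₀ t₁ ×ˢ Icc 0 1))
    (dγ : ∀ t ∈ Ioo t₀ t₁, ∀ a ∈ Icc (0:ℝ) 1, HasDerivAt (fun s => γ s a) (h t a * γ t a) t)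
    (dha : ∀ t ∈ Ioo t₀ t₁, ∀ a ∈ Icc (0:ℝ) 1, HasDerivWithinAt (h t) (ha t a) (Icc 0 1) a)
    (dht : ∀ t ∈ Ioo t₀ t₁, ∀ a ∈ Icc (0:ℝ) 1, HasDerivAt (fun s => h s a) (ht t a) t)
    (dra : ∀ t ∈ Ioo t₀ t₁, ∀ a ∈ Icc (0:ℝ) 1, HasDerivWithinAt (r t) (ra t a) (Icc 0 1) a)
    (drt : ∀ t ∈ Ioo t₀ t₁, ∀ a ∈ Icc (0:ℝ) 1, HasDerivAt (fun s => r s a) (rt t a) t)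
    (hpos : ∀ t ∈ Ioo t₀ t₁, ∀ a, 0 < γ t a)
    (hone : ∀ t ∈ Ioo t₀ t₁, ∫ b in (0:ℝ)..1, γ t b = 1)
    (hrt : ∀ t ∈ Ioo t₀ t₁, ∀ a ∈ Icc (0:ℝ) 1, rt t a = r t a * h t a)
    (hht : ∀ t ∈ Ioo t₀ t₁, ∃ c, ∀ a ∈ Icc (0:ℝ) 1, ht t a - h t a ^ 2 + r t a = c)
    (hr : ∀ t ∈ Ioo t₀ t₁, r t 0 = 0 ∧ r t 1 = 0) :
    ∃ f ρ fx fxx fxt ρt ρx : ℝ → ℝ → ℝ,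
      IsSolWithin (Ioo t₀ t₁) f ρ fx fxx fxt ρt ρx ∧
      (∀ t ∈ Ioo t₀ t₁, fxx t 0 = ha t 0 / γ t 0 ∧ fxx t 1 = ha t 1 / γ t 1) ∧
      ∀ t ∈ Ioo t₀ t₁, (∀ a, γ t a = 1) → ∀ x ∈ Icc (0:ℝ) 1,
        f t x = (∫ b in (0:ℝ)..x, h t b) ∧ ρ t x = r t x := by
  have cγI := cγ.mono (prod_mono (Subset.rfl (s := Ioo t₀ t₁)) (subset_univ (Icc (0:ℝ) 1)))
  have cγt : ContinuousOn (fun y : ℝ × ℝ => h y.1 y.2 * γ y.1 y.2) (Ioo t₀ t₁ ×ˢ Icc 0 1) :=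
    ch.mul cγI
  obtain ⟨α, cα, hαΓ, hα⟩ := exists_inverse_flow (γt := fun t a => h t a * γ t a) cγ cγt dγ
    hpos hone
  have hα0 : ∀ t ∈ Ioo t₀ t₁, α t 0 = 0 := fun t ht => by simpa using hαΓ t ht 0
  have hα1 : ∀ t ∈ Ioo t₀ t₁, α t 1 = 1 := fun t ht => by simpa [hone t ht] using hαΓ t ht 1
  set V : ℝ → ℝ → ℝ := fun t a => ∫ b in (0:ℝ)..a, h t b * γ t b with hV
  have cV : ContinuousOn (fun y : ℝ × ℝ => V y.1 y.2) (Ioo t₀ t₁ ×ˢ Icc 0 1) :=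
    continuousOn_primitive_param (φ := fun t a => h t a * γ t a) cγt
  have one : (1:ℝ) ∈ Icc (0:ℝ) 1 := ⟨zero_le_one, le_rfl⟩
  have hV0 : ∀ t, V t 0 = 0 := fun t => by simp [hV]
  have hV1 : ∀ t ∈ Ioo t₀ t₁, V t 1 = 0 := fun t ht => by
    have hJ : Ioo t₀ t₁ ∈ 𝓝 t := Ioo_mem_nhds ht.1 ht.2
    refine (hasDerivAt_integral_param cγI cγt dγ hJ one).unique ?_
    refine (hasDerivAt_const t (1:ℝ)).congr_of_eventuallyEq ?_
    filter_upwards [hJ] with s hs using hone s hs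
  have dV : ∀ t ∈ Ioo t₀ t₁, ∀ a ∈ Icc (0:ℝ) 1,
      HasDerivWithinAt (V t) (h t a * γ t a) (Icc 0 1) a := fun t ht a haI => by
    have hc := continuousOn_slice (φ := fun t a => h t a * γ t a) cγt ht
    have : Fact (a ∈ Icc (0:ℝ) 1) := ⟨haI⟩
    exact intervalIntegral.integral_hasDerivWithinAt_right
      (intervalIntegrable_of_continuousOn_unit hc haI)
      (hc.stronglyMeasurableAtFilter_nhdsWithin measurableSet_Icc a) (hc a haI)
  have pull : ∀ {u : ℝ → ℝ → ℝ},
      ContinuousOn (fun y : ℝ × ℝ => u y.1 y.2) (Ioo t₀ t₁ ×ˢ Icc 0 1) →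
      ContinuousOn (fun y : ℝ × ℝ => u y.1 (α y.1 y.2)) (Ioo t₀ t₁ ×ˢ Icc 0 1) := fun hu =>
    hu.comp (continuousOn_fst.prodMk cα) fun y hy => ⟨hy.1, (hα y.1 hy.1 y.2 hy.2).1⟩
  have dx : ∀ {u : ℝ → ℝ → ℝ} {ua : ℝ}, ∀ t ∈ Ioo t₀ t₁, ∀ x ∈ Icc (0:ℝ) 1,
      HasDerivWithinAt (u t) ua (Icc 0 1) (α t x) →
      HasDerivWithinAt (fun x => u t (α t x)) (ua / γ t (α t x)) (Icc 0 1) x :=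
    fun {u ua} t ht x hx hu => by
    have := hu.comp x (hα t ht x hx).2.1.hasDerivWithinAt (s := Icc (0:ℝ) 1)
      fun y hy => (hα t ht y hy).1
    rwa [mul_one_div] at this
  have dt : ∀ {u ut : ℝ → ℝ → ℝ} {ua : ℝ},
      ContinuousOn (fun y : ℝ × ℝ => ut y.1 y.2) (Ioo t₀ t₁ ×ˢ Icc 0 1) →
      (∀ t ∈ Ioo t₀ t₁, ∀ a ∈ Icc (0:ℝ) 1, HasDerivAt (fun s => u s a) (ut t a) t) →
      ∀ t ∈ Ioo t₀ t₁, ∀ x ∈ Icc (0:ℝ) 1, HasDerivWithinAt (u t) ua (Icc 0 1) (α t x) →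
      HasDerivAt (fun s => u s (α s x)) (ut t (α t x) + ua * (-V t (α t x) / γ t (α t x))) t :=
    fun hut hd t ht x hx hu => hasDerivAt_along_curve (α := fun s => α s x)
      (Ioo_mem_nhds ht.1 ht.2) hut hd (fun s hs => (hα s hs x hx).1) (hα t ht x hx).2.2 hu
  have hγne : ∀ y ∈ Ioo t₀ t₁ ×ˢ Icc (0:ℝ) 1, γ y.1 (α y.1 y.2) ≠ 0 := fun y hy =>
    (hpos y.1 hy.1 _).ne'
  refine ⟨fun t x => V t (α t x), fun t x => r t (α t x), fun t x => h t (α t x),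
    fun t x => ha t (α t x) / γ t (α t x),
    fun t x => ht t (α t x) + ha t (α t x) * (-V t (α t x) / γ t (α t x)),
    fun t x => rt t (α t x) + ra t (α t x) * (-V t (α t x) / γ t (α t x)),
    fun t x => ra t (α t x) / γ t (α t x), ⟨fun t ht x hx => ?_,
    fun t ht x hx => dx t ht x hx (dha t ht _ (hα t ht x hx).1),
    fun t ht x hx => dt cht dht t ht x hx (dha t ht _ (hα t ht x hx).1),
    fun t ht x hx => dt crt drt t ht x hx (dra t ht _ (hα t ht x hx).1),
    fun t ht x hx => dx t ht x hx (dra t ht _ (hα t ht x hx).1),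
    pull ch, (pull cha).div (pull cγI) hγne,
    (pull cht).add ((pull cha).mul ((pull cV).neg.div (pull cγI) hγne)), pull cV, pull cr,
    (pull crt).add ((pull cra).mul ((pull cV).neg.div (pull cγI) hγne)),
    (pull cra).div (pull cγI) hγne, fun t htJ => ?_, fun t htJ x hx => ?_, fun t htJ => ?_,
    fun t htJ => ?_⟩, fun t htJ => ?_, fun t htJ hid x hx => ?_⟩
  · have := dx t ht x hx (dV t ht _ (hα t ht x hx).1)
    rwa [mul_div_cancel_right₀ _ (hpos t ht _).ne'] at this
  · obtain ⟨c, hc⟩ := hht t htJ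
    refine ⟨c, fun x hx => ?_⟩
    rw [← hc _ (hα t htJ x hx).1]
    ring
  · simp only [hrt t htJ _ (hα t htJ x hx).1]
    ring
  · simp only [hα0 t htJ, hα1 t htJ, hV0, hV1 t htJ, and_self]
  · simpa only [hα0 t htJ, hα1 t htJ] using hr t htJ
  · simp only [hα0 t htJ, hα1 t htJ, and_self]
  · have : α t x = x := by simpa [hid] using hαΓ t htJ x
    simp [this, hV, hid]

/-- The explicit solution of the reduced Boussinesq system driven by the reduced dynamics. -/
lemma exists_isSolWithin_of_reduced {p q p' q' A B G w₀ : ℝ → ℝ} {t₀ t₁ : ℝ}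
    (hp : Continuous p) (hq : Continuous q)
    (hp' : ContinuousOn p' (Icc 0 1)) (hq' : ContinuousOn q' (Icc 0 1))
    (dp : ∀ a ∈ Icc (0:ℝ) 1, HasDerivWithinAt p (p' a) (Icc 0 1) a)
    (dq : ∀ a ∈ Icc (0:ℝ) 1, HasDerivWithinAt q (q' a) (Icc 0 1) a)
    (p0 : p 0 = 0) (p1 : p 1 = 0) (q0 : q 0 = 0) (q1 : q 1 = 0)
    (dA : ∀ t ∈ Ioo t₀ t₁, HasDerivAt A (1 / w₀ t ^ 2) t)
    (dB : ∀ t ∈ Ioo t₀ t₁, HasDerivAt B (G t / w₀ t ^ 2) t)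
    (dG : ∀ t ∈ Ioo t₀ t₁, HasDerivAt G (w₀ t) t)
    (hw : ∀ t ∈ Ioo t₀ t₁, 0 < w₀ t)
    (hD : ∀ t ∈ Ioo t₀ t₁, ∀ x, 0 < 1 + p x * A t + q x * B t)
    (hwD : ∀ t ∈ Ioo t₀ t₁, w₀ t = ∫ x in (0:ℝ)..1, 1 / (1 + p x * A t + q x * B t)) :
    ∃ f ρ fx fxx fxt ρt ρx : ℝ → ℝ → ℝ,
      IsSolWithin (Ioo t₀ t₁) f ρ fx fxx fxt ρt ρx ∧
      (∀ t ∈ Ioo t₀ t₁, fxx t 0 = -(p' 0 + q' 0 * G t) / w₀ t ∧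
        fxx t 1 = -(p' 1 + q' 1 * G t) / w₀ t) ∧
      (0 ∈ Ioo t₀ t₁ → A 0 = 0 → B 0 = 0 → G 0 = 0 → ∀ x ∈ Icc (0:ℝ) 1,
        f 0 x = (∫ b in (0:ℝ)..x, ((∫ y in (0:ℝ)..1, p y) - p b)) ∧ ρ 0 x = q x) := by
  set J := Ioo t₀ t₁ with hJ
  have hJn : ∀ t ∈ J, J ∈ 𝓝 t := fun t ht => Ioo_mem_nhds ht.1 ht.2
  set D : ℝ → ℝ → ℝ := fun t a => 1 + p a * A t + q a * B t with hDdef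
  set P : ℝ → ℝ → ℝ := fun t a => p a + q a * G t with hPdef
  have lift : ∀ {u : ℝ → ℝ}, ContinuousOn u J →
      ContinuousOn (fun y : ℝ × ℝ => u y.1) (J ×ˢ univ) := fun hu =>
    hu.comp continuousOn_fst fun y hy => hy.1
  have cA := lift (u := A) fun t ht => (dA t ht).continuousAt.continuousWithinAt
  have cB := lift (u := B) fun t ht => (dB t ht).continuousAt.continuousWithinAt
  have cG := lift (u := G) fun t ht => (dG t ht).continuousAt.continuousWithinAt
  have cp : ContinuousOn (fun y : ℝ × ℝ => p y.2) (J ×ˢ univ) :=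
    (hp.comp continuous_snd).continuousOn
  have cq : ContinuousOn (fun y : ℝ × ℝ => q y.2) (J ×ˢ univ) :=
    (hq.comp continuous_snd).continuousOn
  have cD : ContinuousOn (fun y : ℝ × ℝ => D y.1 y.2) (J ×ˢ univ) :=
    (continuousOn_const.add (cp.mul cA)).add (cq.mul cB)
  have cP : ContinuousOn (fun y : ℝ × ℝ => P y.1 y.2) (J ×ˢ univ) := cp.add (cq.mul cG)
  have toI : ∀ {u : ℝ → ℝ → ℝ}, ContinuousOn (fun y : ℝ × ℝ => u y.1 y.2) (J ×ˢ univ) →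
      ContinuousOn (fun y : ℝ × ℝ => u y.1 y.2) (J ×ˢ Icc 0 1) := fun hu =>
    hu.mono (prod_mono Subset.rfl (subset_univ _))
  have hDne : ∀ y ∈ J ×ˢ (univ : Set ℝ), D y.1 y.2 ≠ 0 := fun y hy => (hD y.1 hy.1 y.2).ne'
  have c1D : ContinuousOn (fun y : ℝ × ℝ => 1 / D y.1 y.2) (J ×ˢ univ) :=
    continuousOn_const.div cD hDne
  have cw₀ : ContinuousOn w₀ J :=
    (continuousOn_integral_param (toI (u := fun t a => 1 / D t a) c1D)).congr hwD
  have cw := lift cw₀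
  have hwne : ∀ y ∈ J ×ˢ (univ : Set ℝ), w₀ y.1 ≠ 0 := fun y hy => (hw y.1 hy.1).ne'
  have dD : ∀ t ∈ J, ∀ a, HasDerivAt (fun s => D s a) (P t a / w₀ t ^ 2) t := fun t ht a => by
    refine ((((dA t ht).const_mul (p a)).const_add 1).add
      ((dB t ht).const_mul (q a))).congr_deriv ?_
    simp only [hPdef]
    ring
  have dP : ∀ t ∈ J, ∀ a, HasDerivAt (fun s => P s a) (q a * w₀ t) t := fun t ht a =>
    ((dG t ht).const_mul (q a)).const_add (p a)
  have one : (1:ℝ) ∈ Icc (0:ℝ) 1 := ⟨zero_le_one, le_rfl⟩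
  -- the derivative of `w₀`
  set I₁ : ℝ → ℝ := fun t => ∫ a in (0:ℝ)..1, P t a / D t a ^ 2 with hI₁
  have cPD : ContinuousOn (fun y : ℝ × ℝ => P y.1 y.2 / D y.1 y.2 ^ 2) (J ×ˢ univ) :=
    cP.div (cD.pow 2) fun y hy => pow_ne_zero 2 (hDne y hy)
  set m : ℝ → ℝ := fun t => I₁ t / w₀ t ^ 3 with hm
  have dw : ∀ t ∈ J, HasDerivAt w₀ (-m t * w₀ t) t := fun t ht => by
    have h1 := hasDerivAt_integral_param (φ := fun t a => 1 / D t a)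
      (φt := fun t a => -(1 / w₀ t ^ 2) * (P t a / D t a ^ 2)) (toI (u := fun t a => 1 / D t a) c1D)
      (toI (u := fun t a => -(1 / w₀ t ^ 2) * (P t a / D t a ^ 2))
        ((continuousOn_const.div (cw.pow 2) fun y hy => pow_ne_zero 2 (hwne y hy)).neg.mul cPD))
      (fun t ht a _ => by
        have := (hD t ht a).ne'
        refine ((hasDerivAt_const t (1:ℝ)).div (dD t ht a) this).congr_deriv ?_
        ring) (hJn t ht) one
    rw [intervalIntegral.integral_const_mul] at h1
    refine (h1.congr_of_eventuallyEq ?_).congr_deriv ?_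
    · filter_upwards [hJn t ht] with s hs using hwD s hs
    · have := (hw t ht).ne'
      simp only [hm, hI₁]
      field_simp
  -- the derivative of `m`
  set I₂ : ℝ → ℝ := fun t => ∫ a in (0:ℝ)..1,
    (q a * w₀ t / D t a ^ 2 - 2 * P t a ^ 2 / (w₀ t ^ 2 * D t a ^ 3)) with hI₂
  have cφ₂ : ContinuousOn (fun y : ℝ × ℝ => q y.2 * w₀ y.1 / D y.1 y.2 ^ 2
      - 2 * P y.1 y.2 ^ 2 / (w₀ y.1 ^ 2 * D y.1 y.2 ^ 3)) (J ×ˢ univ) :=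
    ((cq.mul cw).div (cD.pow 2) fun y hy => pow_ne_zero 2 (hDne y hy)).sub
      ((continuousOn_const.mul (cP.pow 2)).div ((cw.pow 2).mul (cD.pow 3)) fun y hy =>
        mul_ne_zero (pow_ne_zero 2 (hwne y hy)) (pow_ne_zero 3 (hDne y hy)))
  have cI₁ : ContinuousOn I₁ J :=
    continuousOn_integral_param (toI (u := fun t a => P t a / D t a ^ 2) cPD)
  have cI₂ : ContinuousOn I₂ J := continuousOn_integral_param
    (toI (u := fun t a => q a * w₀ t / D t a ^ 2 - 2 * P t a ^ 2 / (w₀ t ^ 2 * D t a ^ 3)) cφ₂)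
  have dI₁ : ∀ t ∈ J, HasDerivAt I₁ (I₂ t) t := fun t ht => by
    refine hasDerivAt_integral_param (φ := fun t a => P t a / D t a ^ 2)
      (φt := fun t a => q a * w₀ t / D t a ^ 2 - 2 * P t a ^ 2 / (w₀ t ^ 2 * D t a ^ 3))
      (toI (u := fun t a => P t a / D t a ^ 2) cPD)
      (toI (u := fun t a => q a * w₀ t / D t a ^ 2 - 2 * P t a ^ 2 / (w₀ t ^ 2 * D t a ^ 3)) cφ₂)
      (fun t ht a _ => ?_) (hJn t ht) one
    have h1 := (hD t ht a).ne'
    have h2 := (hw t ht).ne'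
    have h3 : D t a ≠ 0 := h1
    refine ((dP t ht a).div ((dD t ht a).pow 2) (pow_ne_zero 2 h1)).congr_deriv ?_
    simp only [Pi.pow_apply]
    field_simp
    push_cast
    ring
  set m' : ℝ → ℝ := fun t => I₂ t / w₀ t ^ 3 + 3 * I₁ t * m t / w₀ t ^ 3 with hm'
  have dm : ∀ t ∈ J, HasDerivAt m (m' t) t := fun t ht => by
    have h2 := (hw t ht).ne'
    refine ((dI₁ t ht).div ((dw t ht).pow 3) (pow_ne_zero 3 h2)).congr_deriv ?_
    simp only [hm', Pi.pow_apply]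
    field_simp
    push_cast
    ring
  have hw3 : ∀ t ∈ J, w₀ t ^ 3 ≠ 0 := fun t ht => pow_ne_zero 3 (hw t ht).ne'
  have cm₀ : ContinuousOn m J := cI₁.div (cw₀.pow 3) hw3
  have cm := lift cm₀
  have cm' := lift (u := m') ((cI₂.div (cw₀.pow 3) hw3).add
    (((continuousOn_const.mul cI₁).mul cm₀).div (cw₀.pow 3) hw3))
  -- Lagrangian quantities
  set γ : ℝ → ℝ → ℝ := fun t a => 1 / (w₀ t * D t a) with hγ
  set h : ℝ → ℝ → ℝ := fun t a => m t - P t a / (w₀ t ^ 2 * D t a) with hh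
  have cγ : ContinuousOn (fun y : ℝ × ℝ => γ y.1 y.2) (J ×ˢ univ) :=
    continuousOn_const.div (cw.mul cD) fun y hy => mul_ne_zero (hwne y hy) (hDne y hy)
  have ch : ContinuousOn (fun y : ℝ × ℝ => h y.1 y.2) (J ×ˢ univ) :=
    cm.sub (cP.div ((cw.pow 2).mul cD) fun y hy =>
      mul_ne_zero (pow_ne_zero 2 (hwne y hy)) (hDne y hy))
  have cp' : ContinuousOn (fun y : ℝ × ℝ => p' y.2) (J ×ˢ Icc 0 1) :=
    hp'.comp continuousOn_snd fun y hy => hy.2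
  have cq' : ContinuousOn (fun y : ℝ × ℝ => q' y.2) (J ×ˢ Icc 0 1) :=
    hq'.comp continuousOn_snd fun y hy => hy.2
  have dDa : ∀ t, ∀ a ∈ Icc (0:ℝ) 1,
      HasDerivWithinAt (D t) (p' a * A t + q' a * B t) (Icc 0 1) a := fun t a ha =>
    (((dp a ha).mul_const (A t)).const_add 1).add ((dq a ha).mul_const (B t))
  have dPa : ∀ t, ∀ a ∈ Icc (0:ℝ) 1,
      HasDerivWithinAt (P t) (p' a + q' a * G t) (Icc 0 1) a := fun t a ha =>
    (dp a ha).add ((dq a ha).mul_const (G t))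
  have hsub : J ×ˢ Icc (0:ℝ) 1 ⊆ J ×ˢ univ := prod_mono Subset.rfl (subset_univ _)
  have cDa : ContinuousOn (fun y : ℝ × ℝ => p' y.2 * A y.1 + q' y.2 * B y.1) (J ×ˢ Icc 0 1) :=
    (cp'.mul (cA.mono hsub)).add (cq'.mul (cB.mono hsub))
  have cPa : ContinuousOn (fun y : ℝ × ℝ => p' y.2 + q' y.2 * G y.1) (J ×ˢ Icc 0 1) :=
    cp'.add (cq'.mul (cG.mono hsub))
  obtain ⟨f, ρ, fx, fxx, fxt, ρt, ρx, hsol, hend, hid⟩ := exists_isSolWithin_of_lagrangian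
    (t₀ := t₀) (t₁ := t₁) (γ := γ) (h := h)
    (ha := fun t a => -(((p' a + q' a * G t) * D t a - P t a * (p' a * A t + q' a * B t)) /
      (w₀ t ^ 2 * D t a ^ 2)))
    (ht := fun t a => m' t - q a * γ t a + h t a ^ 2 - m t ^ 2)
    (r := fun t a => q a * γ t a)
    (ra := fun t a => q' a * γ t a - q a * (p' a * A t + q' a * B t) / (w₀ t * D t a ^ 2))
    (rt := fun t a => q a * γ t a * h t a) cγ (ch.mono hsub)
    (((cPa.mul (cD.mono hsub)).sub ((cP.mono hsub).mul cDa)).div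
      (((cw.pow 2).mul (cD.pow 2)).mono hsub) fun y hy =>
        mul_ne_zero (pow_ne_zero 2 (hwne y (hsub hy))) (pow_ne_zero 2 (hDne y (hsub hy)))).neg
    ((((cm'.sub (cq.mul cγ)).add (ch.pow 2)).sub (cm.pow 2)).mono hsub)
    ((cq.mul cγ).mono hsub)
    ((cq'.mul (cγ.mono hsub)).sub (((cq.mono hsub).mul cDa).div
      ((cw.mul (cD.pow 2)).mono hsub) fun y hy =>
        mul_ne_zero (hwne y (hsub hy)) (pow_ne_zero 2 (hDne y (hsub hy)))))
    (((cq.mul cγ).mul ch).mono hsub)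
    (fun t ht a _ => by
      have h1 : D t a ≠ 0 := (hD t ht a).ne'
      have h2 := (hw t ht).ne'
      refine ((hasDerivAt_const t (1:ℝ)).div ((dw t ht).mul (dD t ht a))
        (mul_ne_zero h2 h1)).congr_deriv ?_
      simp only [hh, hγ, Pi.mul_apply]
      field_simp
      ring)
    (fun t ht a ha => by
      have h1 : D t a ≠ 0 := (hD t ht a).ne'
      have h2 := (hw t ht).ne'
      refine (((dPa t a ha).div ((dDa t a ha).const_mul (w₀ t ^ 2))
        (mul_ne_zero (pow_ne_zero 2 h2) h1)).const_sub (m t)).congr_deriv ?_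
      field_simp)
    (fun t ht a _ => by
      have h1 : D t a ≠ 0 := (hD t ht a).ne'
      have h2 := (hw t ht).ne'
      refine ((dm t ht).sub ((dP t ht a).div (((dw t ht).pow 2).mul (dD t ht a))
        (mul_ne_zero (pow_ne_zero 2 h2) h1))).congr_deriv ?_
      simp only [hh, hγ, Pi.pow_apply, Pi.mul_apply]
      field_simp
      push_cast
      ring)
    (fun t ht a ha => by
      have h1 : D t a ≠ 0 := (hD t ht a).ne'
      have h2 := (hw t ht).ne'
      refine ((dq a ha).mul ((hasDerivWithinAt_const a _ (1:ℝ)).div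
        ((dDa t a ha).const_mul (w₀ t)) (mul_ne_zero h2 h1))).congr_deriv ?_
      simp only [hγ, Pi.div_apply]
      field_simp
      ring)
    (fun t ht a _ => by
      have h1 : D t a ≠ 0 := (hD t ht a).ne'
      have h2 := (hw t ht).ne'
      refine (((hasDerivAt_const t (1:ℝ)).div ((dw t ht).mul (dD t ht a))
        (mul_ne_zero h2 h1)).const_mul (q a)).congr_deriv ?_
      simp only [hh, hγ, Pi.mul_apply]
      field_simp
      ring)
    (fun t ht a => one_div_pos.2 (mul_pos (hw t ht) (hD t ht a)))
    (fun t ht => by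
      have e : ∀ a, γ t a = 1 / w₀ t * (1 / D t a) := fun a =>
        (one_div_mul_one_div _ _).symm
      simp only [e]
      rw [intervalIntegral.integral_const_mul, ← hwD t ht, one_div_mul_cancel (hw t ht).ne'])
    (fun _ _ _ _ => rfl)
    (fun t _ => ⟨m' t - m t ^ 2, fun a _ => by ring⟩)
    (fun t _ => by simp [q0, q1])
  refine ⟨f, ρ, fx, fxx, fxt, ρt, ρx, hsol, fun t ht => ?_, fun h0 hA0 hB0 hG0 x hx => ?_⟩
  · have h2 := (hw t ht).ne'
    rw [(hend t ht).1, (hend t ht).2]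
    simp only [hγ, hDdef, hPdef, p0, p1, q0, q1]
    constructor <;>
    · field_simp
      ring
  · have hD0 : ∀ a, D 0 a = 1 := fun a => by simp [hDdef, hA0, hB0]
    have hP0 : ∀ a, P 0 a = p a := fun a => by simp [hPdef, hG0]
    have hw0 : w₀ 0 = 1 := by
      rw [hwD 0 h0]
      simp [hA0, hB0]
    have hγ0 : ∀ a, γ 0 a = 1 := fun a => by simp [hγ, hD0, hw0]
    obtain ⟨e1, e2⟩ := hid 0 h0 hγ0 x hx
    rw [e1, e2]
    simp [hh, hm, hI₁, hD0, hP0, hw0, hγ0]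

/-- A solution whose second derivative blows up at both endpoints at a finite time. -/
lemma exists_two_sided_blowup {f₀ ρ₀ f₀d f₀dd : ℝ → ℝ}
    (hf₀smooth : ContDiffOn ℝ (⊤ : ℕ∞) f₀ (Icc (0:ℝ) 1))
    (hρ₀smooth : ContDiffOn ℝ (⊤ : ℕ∞) ρ₀ (Icc (0:ℝ) 1))
    (hf₀d : ∀ x ∈ Icc (0:ℝ) 1, HasDerivAt f₀ (f₀d x) x)
    (hf₀dd : ∀ x ∈ Icc (0:ℝ) 1, HasDerivAt f₀d (f₀dd x) x)
    (hbcf₀ : f₀ 0 = 0 ∧ f₀ 1 = 0) (hbcρ₀ : ρ₀ 0 = 0 ∧ ρ₀ 1 = 0)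
    (hρ₀pos : ∀ x ∈ Icc (0:ℝ) 1, 0 ≤ ρ₀ x) {M₀ : ℝ}
    (hub : ∀ x ∈ Icc (0:ℝ) 1, f₀d x ≤ M₀) (hatt0 : f₀d 0 = M₀) (hatt1 : f₀d 1 = M₀)
    (honly : ∀ x ∈ Ioo (0:ℝ) 1, f₀d x < M₀) (hvort0 : f₀dd 0 < 0) (hvort1 : 0 < f₀dd 1) :
    ∃ (t₁ : ℝ) (g σ gx gxx gxt σt σx : ℝ → ℝ → ℝ), 0 < t₁ ∧
      IsClassicalSol (ENNReal.ofReal t₁) g σ gx gxx gxt σt σx ∧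
      (∀ x ∈ Icc (0:ℝ) 1, g 0 x = f₀ x ∧ σ 0 x = ρ₀ x) ∧
      Tendsto (fun t => gxx t 0) (𝓝[<] t₁) atBot ∧
      Tendsto (fun t => gxx t 1) (𝓝[<] t₁) atTop := by
  have m0 : (0:ℝ) ∈ Icc (0:ℝ) 1 := ⟨le_rfl, zero_le_one⟩
  have m1 : (1:ℝ) ∈ Icc (0:ℝ) 1 := ⟨zero_le_one, le_rfl⟩
  have ud : UniqueDiffOn ℝ (Icc (0:ℝ) 1) := uniqueDiffOn_Icc_zero_one
  have cf₀d : ContinuousOn f₀d (Icc 0 1) := fun x hx =>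
    (hf₀dd x hx).continuousAt.continuousWithinAt
  have smd : ContDiffOn ℝ 1 f₀d (Icc 0 1) :=
    (hf₀smooth.derivWithin ud (m := 1) (WithTop.coe_le_coe.2 (le_top : (1 + 1 : ℕ∞) ≤ ⊤))).congr
      fun x hx => ((hf₀d x hx).hasDerivWithinAt.derivWithin (ud x hx)).symm
  have cf₀dd : ContinuousOn f₀dd (Icc 0 1) :=
    (smd.continuousOn_derivWithin ud le_rfl).congr
      fun x hx => ((hf₀dd x hx).hasDerivWithinAt.derivWithin (ud x hx)).symm
  have cρ₀x : ContinuousOn (derivWithin ρ₀ (Icc 0 1)) (Icc 0 1) :=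
    hρ₀smooth.continuousOn_derivWithin ud (by exact_mod_cast le_top)
  have hρ₀x : ∀ x ∈ Icc (0:ℝ) 1,
      HasDerivWithinAt ρ₀ (derivWithin ρ₀ (Icc 0 1) x) (Icc 0 1) x := fun x hx =>
    (hρ₀smooth.differentiableOn (by simp) x hx).hasDerivWithinAt
  set π : ℝ → ℝ := fun x => projIcc (0:ℝ) 1 zero_le_one x with hπ
  have πc : Continuous π := continuous_subtype_val.comp continuous_projIcc
  have πm : ∀ x, π x ∈ Icc (0:ℝ) 1 := fun x => (projIcc (0:ℝ) 1 zero_le_one x).2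
  have πe : ∀ x ∈ Icc (0:ℝ) 1, π x = x := fun x hx => by
    simp [hπ, projIcc_of_mem zero_le_one hx]
  set p : ℝ → ℝ := fun x => M₀ - f₀d (π x) with hp
  set q : ℝ → ℝ := fun x => ρ₀ (π x) with hq
  have pe : ∀ x ∈ Icc (0:ℝ) 1, p x = M₀ - f₀d x := fun x hx => by simp only [hp, πe x hx]
  have qe : ∀ x ∈ Icc (0:ℝ) 1, q x = ρ₀ x := fun x hx => by simp only [hq, πe x hx]
  have pc : Continuous p := continuous_const.sub (cf₀d.comp_continuous πc πm)
  have qc : Continuous q := hρ₀smooth.continuousOn.comp_continuous πc πm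
  have dp : ∀ a ∈ Icc (0:ℝ) 1, HasDerivWithinAt p (-f₀dd a) (Icc 0 1) a := fun a ha =>
    ((hf₀dd a ha).const_sub M₀).hasDerivWithinAt.congr pe (pe a ha)
  have dq : ∀ a ∈ Icc (0:ℝ) 1,
      HasDerivWithinAt q (derivWithin ρ₀ (Icc 0 1) a) (Icc 0 1) a := fun a ha =>
    (hρ₀x a ha).congr qe (qe a ha)
  have p0 : p 0 = 0 := by rw [pe 0 m0, hatt0, sub_self]
  have p1 : p 1 = 0 := by rw [pe 1 m1, hatt1, sub_self]
  have q0 : q 0 = 0 := by rw [qe 0 m0, hbcρ₀.1]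
  have q1 : q 1 = 0 := by rw [qe 1 m1, hbcρ₀.2]
  have pnn : ∀ x, 0 ≤ p x := fun x => sub_nonneg.2 (hub _ (πm x))
  have qnn : ∀ x, 0 ≤ q x := fun x => hρ₀pos _ (πm x)
  obtain ⟨P, hP⟩ := isCompact_Icc.bddAbove_image (f := fun x => M₀ - f₀d x)
    (continuousOn_const.sub cf₀d)
  obtain ⟨Q, hQ⟩ := isCompact_Icc.bddAbove_image hρ₀smooth.continuousOn
  obtain ⟨c, hc, hpc⟩ := exists_parabola_le pc.continuousOn (neg_pos.2 hvort0) hvort1 p0 p1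
    (dp 0 m0) (dp 1 m1) fun x hx => by
      rw [pe x (Ioo_subset_Icc_self hx)]
      exact sub_pos.2 (honly x hx)
  obtain ⟨A, B, G, w₀, t₀, t₁, ht₀, ht₁, hA0, hB0, hG0, hode, hGnn, hwlim⟩ :=
    exists_reduced_solution pc qc pnn qnn (P := P) (Q := Q)
      (fun x => hP ⟨π x, πm x, rfl⟩) (fun x => hQ ⟨π x, πm x, rfl⟩) hc hpc
  obtain ⟨g, σ, gx, gxx, gxt, σt, σx, hsol, hend, hid⟩ :=
    exists_isSolWithin_of_reduced (p' := fun a => -f₀dd a) pc qc cf₀dd.neg cρ₀x dp dq p0 p1 q0 q1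
      (fun t ht => (hode t ht).1) (fun t ht => (hode t ht).2.1) (fun t ht => (hode t ht).2.2.1)
      (fun t ht => (hode t ht).2.2.2.1) (fun t ht => (hode t ht).2.2.2.2.1)
      (fun t ht => (hode t ht).2.2.2.2.2)
  have hsub : timeSet (ENNReal.ofReal t₁) ⊆ Ioo t₀ t₁ := fun t ht =>
    ⟨ht₀.trans_le ht.1, (ENNReal.ofReal_lt_ofReal_iff ht₁).1 ht.2⟩
  have hftc : ∀ x ∈ Icc (0:ℝ) 1, ∫ b in (0:ℝ)..x, f₀d b = f₀ x := fun x hx => by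
    have hs : uIcc 0 x ⊆ Icc (0:ℝ) 1 := by
      rw [uIcc_of_le hx.1]
      exact Icc_subset_Icc_right hx.2
    rw [intervalIntegral.integral_eq_sub_of_hasDerivAt (fun y hy => hf₀d y (hs hy))
      (cf₀d.mono hs).intervalIntegrable, hbcf₀.1, sub_zero]
  have hpint : ∫ y in (0:ℝ)..1, p y = M₀ := by
    have : ∫ y in (0:ℝ)..1, p y = ∫ y in (0:ℝ)..1, (M₀ - f₀d y) :=
      intervalIntegral.integral_congr fun y hy => pe y (by rwa [uIcc_of_le zero_le_one] at hy)
    rw [this, intervalIntegral.integral_sub intervalIntegrable_const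
      (intervalIntegrable_of_continuousOn_unit cf₀d m1), hftc 1 m1, hbcf₀.2]
    simp
  have qx0 : 0 ≤ derivWithin ρ₀ (Icc 0 1) 0 := by
    have hmin : IsMinOn ρ₀ (Icc 0 1) 0 := fun x hx => hbcρ₀.1.trans_le (hρ₀pos x hx)
    simpa using hmin.localize.hasFDerivWithinAt_nonneg (hρ₀x 0 m0).hasFDerivWithinAt
      (sub_mem_posTangentConeAt_of_segment_subset (y := 1)
        ((convex_Icc 0 1).segment_subset m0 m1))
  have qx1 : derivWithin ρ₀ (Icc 0 1) 1 ≤ 0 := by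
    have hmin : IsMinOn ρ₀ (Icc 0 1) 1 := fun x hx => hbcρ₀.2.trans_le (hρ₀pos x hx)
    simpa using hmin.localize.hasFDerivWithinAt_nonneg (hρ₀x 1 m1).hasFDerivWithinAt
      (sub_mem_posTangentConeAt_of_segment_subset (y := 0)
        ((convex_Icc 0 1).segment_subset m1 m0))
  have hev : ∀ᶠ t in 𝓝[<] t₁, t ∈ Ico 0 t₁ := Ico_mem_nhdsLT ht₁
  have hinv : Tendsto (fun t => (w₀ t)⁻¹) (𝓝[<] t₁) atTop := by
    refine tendsto_inv_nhdsGT_zero.comp (tendsto_nhdsWithin_iff.2 ⟨hwlim, ?_⟩)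
    filter_upwards [hev] with t ht using (hode t ⟨ht₀.trans_le ht.1, ht.2⟩).2.2.2.1
  refine ⟨t₁, _, _, _, _, _, _, _, ht₁, hsol.isClassicalSol isOpen_Ioo hsub, fun x hx => ?_, ?_, ?_⟩
  · obtain ⟨e1, e2⟩ := hid ⟨ht₀, ht₁⟩ hA0 hB0 hG0 x hx
    refine ⟨?_, by rw [unitExtend_of_mem hx, e2, qe x hx]⟩
    rw [unitExtend_of_mem hx, e1, ← hftc x hx]
    refine intervalIntegral.integral_congr fun y hy => ?_
    rw [uIcc_of_le hx.1] at hy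
    simp only [hpint, pe y ⟨hy.1, hy.2.trans hx.2⟩, sub_sub_cancel]
  · refine tendsto_atBot_mono' _ ?_ (hinv.const_mul_atTop_of_neg hvort0)
    filter_upwards [hev] with t ht
    have hJ : t ∈ Ioo t₀ t₁ := ⟨ht₀.trans_le ht.1, ht.2⟩
    rw [(hend t hJ).1, div_eq_mul_inv]
    refine mul_le_mul_of_nonneg_right ?_ (inv_nonneg.2 (hode t hJ).2.2.2.1.le)
    linarith [mul_nonneg qx0 (hGnn t ht)]
  · refine tendsto_atTop_mono' _ ?_ (hinv.const_mul_atTop hvort1)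
    filter_upwards [hev] with t ht
    have hJ : t ∈ Ioo t₀ t₁ := ⟨ht₀.trans_le ht.1, ht.2⟩
    rw [(hend t hJ).2, div_eq_mul_inv]
    refine mul_le_mul_of_nonneg_right ?_ (inv_nonneg.2 (hode t hJ).2.2.2.1.le)
    linarith [mul_nonneg (neg_nonneg.2 qx1) (hGnn t ht)]

/-- Two classical solutions with the same initial data have the same second derivative. -/
lemma IsClassicalSol.fxx_unique {T₁ T₂ : ℝ≥0∞}
    {f ρ fx fxx fxt ρt ρx g r gx gxx gxt rt rx : ℝ → ℝ → ℝ}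
    (h₁ : IsClassicalSol T₁ f ρ fx fxx fxt ρt ρx) (h₂ : IsClassicalSol T₂ g r gx gxx gxt rt rx)
    (h0 : ∀ x ∈ Icc (0:ℝ) 1, f 0 x = g 0 x ∧ ρ 0 x = r 0 x) {t : ℝ}
    (ht₁ : t ∈ timeSet T₁) (ht₂ : t ∈ timeSet T₂) {x : ℝ} (hx : x ∈ Icc (0:ℝ) 1) :
    fxx t x = gxx t x :=
  deriv_eq_of_eqOn_unit
    (fun y hy => deriv_eq_of_eqOn_unit (fun z hz => (h₁.unique h₂ h0 ht₁ ht₂ z hz).1) hy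
      (h₁.hfx t ht₁ y hy) (h₂.hfx t ht₂ y hy)) hx (h₁.hfxx t ht₁ x hx) (h₂.hfxx t ht₂ x hx)

end

/-- (Corollary 3.3: two-sided blowup of the vorticity.) Let `f₀, ρ₀` be
smooth with `f₀` nontrivial, Dirichlet data, `ρ₀ ≥ 0`, and suppose `M₀ = max f₀' > 0` is
attained exactly at `x = 0` and `x = 1` with `f₀''(0) < 0 < f₀''(1)`.  If `(f, ρ)` is a
classical solution of the reduced Boussinesq system with this initial data on a maximal
interval `[0,T)` (no extension to a larger time interval exists), then `T < ∞`,
`f_{xx}(t,0) → -∞` and `f_{xx}(t,1) → +∞` as `t → T⁻`. -/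
theorem stmt15 (f₀ ρ₀ f₀d f₀dd : ℝ → ℝ)
    (hf₀smooth : ContDiffOn ℝ (⊤ : ℕ∞) f₀ (Icc (0:ℝ) 1))
    (hρ₀smooth : ContDiffOn ℝ (⊤ : ℕ∞) ρ₀ (Icc (0:ℝ) 1))
    (hf₀d : ∀ x ∈ Icc (0:ℝ) 1, HasDerivAt f₀ (f₀d x) x)
    (hf₀dd : ∀ x ∈ Icc (0:ℝ) 1, HasDerivAt f₀d (f₀dd x) x)
    (hne : ∃ x ∈ Icc (0:ℝ) 1, f₀ x ≠ 0)
    (hbcf₀ : f₀ 0 = 0 ∧ f₀ 1 = 0) (hbcρ₀ : ρ₀ 0 = 0 ∧ ρ₀ 1 = 0)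
    (hρ₀pos : ∀ x ∈ Icc (0:ℝ) 1, 0 ≤ ρ₀ x)
    (M₀ : ℝ) (hM₀pos : 0 < M₀)
    (hub : ∀ x ∈ Icc (0:ℝ) 1, f₀d x ≤ M₀)
    (hatt0 : f₀d 0 = M₀) (hatt1 : f₀d 1 = M₀)
    (honly : ∀ x ∈ Ioo (0:ℝ) 1, f₀d x < M₀)
    (hvort0 : f₀dd 0 < 0) (hvort1 : 0 < f₀dd 1)
    (T : ℝ≥0∞) (hT : 0 < T)
    (f ρ fx fxx fxt ρt ρx : ℝ → ℝ → ℝ)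
    (hsol : IsClassicalSol T f ρ fx fxx fxt ρt ρx)
    (hinit : ∀ x ∈ Icc (0:ℝ) 1, f 0 x = f₀ x ∧ ρ 0 x = ρ₀ x)
    (hmax : ∀ T' : ℝ≥0∞, T < T' →
      ¬ ∃ g σ gx gxx gxt σt σx : ℝ → ℝ → ℝ,
        IsClassicalSol T' g σ gx gxx gxt σt σx ∧
        ∀ t ∈ timeSet T, ∀ x ∈ Icc (0:ℝ) 1, g t x = f t x ∧ σ t x = ρ t x) :
    T < ⊤ ∧
    Tendsto (fun t => fxx t 0) (nhdsWithin T.toReal (Iio T.toReal)) atBot ∧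
    Tendsto (fun t => fxx t 1) (nhdsWithin T.toReal (Iio T.toReal)) atTop := by
  have m0 : (0:ℝ) ∈ Icc (0:ℝ) 1 := ⟨le_rfl, zero_le_one⟩
  have m1 : (1:ℝ) ∈ Icc (0:ℝ) 1 := ⟨zero_le_one, le_rfl⟩
  obtain ⟨t₁, g, σ, gx, gxx, gxt, σt, σx, ht₁, hg, hg0, hbot, htop⟩ :=
    exists_two_sided_blowup hf₀smooth hρ₀smooth hf₀d hf₀dd hbcf₀ hbcρ₀ hρ₀pos hub hatt0 hatt1
      honly hvort0 hvort1
  have h0 : ∀ x ∈ Icc (0:ℝ) 1, f 0 x = g 0 x ∧ ρ 0 x = σ 0 x := fun x hx =>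
    ⟨(hinit x hx).1.trans (hg0 x hx).1.symm, (hinit x hx).2.trans (hg0 x hx).2.symm⟩
  have hmem : ∀ {t}, t ∈ Ico 0 t₁ → t ∈ timeSet (ENNReal.ofReal t₁) := fun ht =>
    ⟨ht.1, (ENNReal.ofReal_lt_ofReal_iff ht₁).2 ht.2⟩
  have hev : ∀ᶠ t in 𝓝[<] t₁, t ∈ Ico 0 t₁ := Ico_mem_nhdsLT ht₁
  have hle : ENNReal.ofReal t₁ ≤ T := le_of_not_gt fun hlt =>
    hmax _ hlt ⟨g, σ, gx, gxx, gxt, σt, σx, hg, fun t ht x hx =>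
      have h := hsol.unique hg h0 ht ⟨ht.1, ht.2.trans hlt⟩ x hx
      ⟨h.1.symm, h.2.symm⟩⟩
  have heq : ∀ x ∈ Icc (0:ℝ) 1, (fun t => gxx t x) =ᶠ[𝓝[<] t₁] fun t => fxx t x := fun x hx => by
    filter_upwards [hev] with t ht
    exact (hsol.fxx_unique hg h0 ⟨ht.1, (hmem ht).2.trans_le hle⟩ (hmem ht) hx).symm
  have hbot' := hbot.congr' (heq 0 m0)
  have hTt : T = ENNReal.ofReal t₁ := by
    refine le_antisymm (le_of_not_gt fun hlt => ?_) hle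
    have hc : Tendsto (fun t => fxx t 0) (𝓝[<] t₁) (𝓝 (fxx t₁ 0)) := by
      refine (continuousOn_slice_left hsol.hcfxx m0 t₁ ⟨ht₁.le, hlt⟩).mono_left ?_
      refine nhdsWithin_le_of_mem ?_
      filter_upwards [hev] with t ht using ⟨ht.1, (hmem ht).2.trans hlt⟩
    exact not_tendsto_nhds_of_tendsto_atBot hbot' _ hc
  rw [hTt, ENNReal.toReal_ofReal ht₁.le]
  exact ⟨ENNReal.ofReal_lt_top, hbot', htop.congr' (heq 1 m1)⟩
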